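/- arXiv:2602.04128 — 2 statements merged into one kernel-verified Lean document; each statement's English description precedes it below -/
import Mathlib

section
/- For all real numbers n ≥ 1 (integer n), one has the identity ∑_{n=1}^∞ (10n² − 6n + 1)/n⁵ · (n!)⁵(−1/4)ⁿ / ([1/2]_n)⁵ = −28ζ(3), where [a]_n = a(a+1)⋯(a+n−1) is the Pochhammer symbol and ζ is the Riemann zeta function. -/
/-- Pochhammer symbol `[a]_n = a(a+1)⋯(a+n-1)`. -/
noncomputable def poch (a : ℝ) (n : ℕ) : ℝ := ∏ k ∈ Finset.range n, (a + k)

open Filter Topology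

/-- `∏_{j<k} (j+1/2)/(n+j+3/2) = [1/2]_k / [n+3/2]_k`. -/
noncomputable def pochRatio (n k : ℕ) : ℝ :=
  ∏ j ∈ Finset.range k, ((j : ℝ) + 1 / 2) / ((n : ℝ) + j + 3 / 2)

/-- `(-1/4)ⁿ n!⁵ / ([1/2]_n [3/2]_n⁴)`, written as a product. -/
noncomputable def wzCoeff (n : ℕ) : ℝ :=
  ∏ j ∈ Finset.range n,
    (-(((j : ℝ) + 1) ^ 5 / (4 * ((j : ℝ) + 1 / 2) * ((j : ℝ) + 3 / 2) ^ 4)))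

/-- First member of the Wilf–Zeilberger pair. -/
noncomputable def wzF (n k : ℕ) : ℝ :=
  (2 * k + 1 + n) * (wzCoeff n * pochRatio n k ^ 4)

/-- The rational certificate of the Wilf–Zeilberger pair, a quadratic polynomial in `k`. -/
noncomputable def wzCert (n k : ℕ) : ℝ :=
  (((k : ℝ) + (n + 2) / 2) ^ 2 + 2 * n * ((k : ℝ) + (n + 2) / 2) + 5 / 4 * ((n : ℝ) + 1) ^ 2)
    / (2 * n + 1) - 1

/-- Second member of the Wilf–Zeilberger pair. -/
noncomputable def wzG (n k : ℕ) : ℝ := wzCert n k * (wzCoeff n * pochRatio n k ^ 4)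

lemma pochRatio_succ_right (n k : ℕ) :
    pochRatio n (k + 1) = pochRatio n k * (((k : ℝ) + 1 / 2) / ((n : ℝ) + k + 3 / 2)) :=
  Finset.prod_range_succ _ _

lemma pochRatio_succ_left (n k : ℕ) :
    pochRatio (n + 1) k = pochRatio n k * (((n : ℝ) + 3 / 2) / ((n : ℝ) + k + 3 / 2)) := by
  induction k with
  | zero =>
    have : (n : ℝ) + 3 / 2 ≠ 0 := by positivity
    simp [pochRatio, this]
  | succ k ih =>
    rw [pochRatio_succ_right, pochRatio_succ_right, ih]
    push_cast
    have h₁ : (n : ℝ) + k + 3 / 2 ≠ 0 := by positivity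
    have h₂ : (n : ℝ) + 1 + k + 3 / 2 ≠ 0 := by positivity
    have h₃ : (n : ℝ) + (k + 1) + 3 / 2 ≠ 0 := by positivity
    field_simp
    ring

lemma pochRatio_zero_left (k : ℕ) : pochRatio 0 k = 1 / (2 * k + 1) := by
  induction k with
  | zero => simp [pochRatio]
  | succ k ih =>
    rw [pochRatio_succ_right, ih]
    push_cast
    have h₁ : (2 * k + 1 : ℝ) ≠ 0 := by positivity
    have h₂ : (0 + k + 3 / 2 : ℝ) ≠ 0 := by positivity
    have h₃ : (2 * (k + 1) + 1 : ℝ) ≠ 0 := by positivity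
    field_simp
    ring

lemma pochRatio_nonneg (n k : ℕ) : 0 ≤ pochRatio n k :=
  Finset.prod_nonneg fun _ _ => by positivity

lemma pochRatio_le (n k : ℕ) : pochRatio n k ≤ 1 / (2 * k + 1) := by
  rw [← pochRatio_zero_left]
  refine Finset.prod_le_prod (fun _ _ => by positivity) fun j _ => ?_
  gcongr
  exact_mod_cast Nat.zero_le n

lemma wzCoeff_succ (n : ℕ) :
    wzCoeff (n + 1) =
      wzCoeff n * (-(((n : ℝ) + 1) ^ 5 / (4 * ((n : ℝ) + 1 / 2) * ((n : ℝ) + 3 / 2) ^ 4))) :=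
  Finset.prod_range_succ _ _

lemma abs_wzCoeff_le (n : ℕ) : |wzCoeff n| ≤ (1 / 2) ^ n := by
  induction n with
  | zero => simp [wzCoeff]
  | succ n ih =>
    rw [wzCoeff_succ, abs_mul, pow_succ (1 / 2 : ℝ), abs_neg,
      abs_of_nonneg (a := _ / _) (by positivity)]
    refine mul_le_mul ih ?_ (by positivity) (by positivity)
    rw [div_le_iff₀ (by positivity), pow_succ]
    have h : ((n : ℝ) + 1) ^ 4 ≤ ((n : ℝ) + 3 / 2) ^ 4 := by gcongr; norm_num
    calc ((n : ℝ) + 1) ^ 4 * (n + 1) ≤ ((n : ℝ) + 3 / 2) ^ 4 * (2 * n + 1) := by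
          gcongr
          linarith [(Nat.cast_nonneg n : (0 : ℝ) ≤ n)]
      _ = _ := by ring

/-- The Wilf–Zeilberger equation. -/
lemma wzF_sub_wzF_succ (n k : ℕ) : wzF n k - wzF (n + 1) k = wzG n k - wzG n (k + 1) := by
  simp only [wzF, wzG, wzCert, pochRatio_succ_right, pochRatio_succ_left, wzCoeff_succ]
  push_cast
  have h₁ : (n : ℝ) + k + 3 / 2 ≠ 0 := by positivity
  have h₂ : (n : ℝ) + 3 / 2 ≠ 0 := by positivity
  have h₃ : (n : ℝ) + 1 / 2 ≠ 0 := by positivity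
  have h₄ : 2 * (n : ℝ) + 1 ≠ 0 := by positivity
  rw [show (n : ℝ) + 1 / 2 = (2 * n + 1) / 2 by ring]
  generalize wzCoeff n = c
  generalize pochRatio n k = p
  field_simp
  ring

lemma abs_wzF_le (n k : ℕ) :
    |wzF n k| ≤ ((n : ℝ) + 1) * (1 / 2) ^ n * (1 / ((k : ℝ) + 1) ^ 3) := by
  have hp := pochRatio_nonneg n k
  rw [wzF, abs_mul, abs_mul, abs_of_nonneg (by positivity : (0 : ℝ) ≤ 2 * k + 1 + n),
    abs_of_nonneg (by positivity : 0 ≤ pochRatio n k ^ 4)]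
  calc (2 * k + 1 + n : ℝ) * (|wzCoeff n| * pochRatio n k ^ 4)
      ≤ ((n + 1) * (2 * k + 1)) * ((1 / 2) ^ n * (1 / (2 * k + 1)) ^ 4) := by
        gcongr
        · nlinarith [(by positivity : (0 : ℝ) ≤ n * k)]
        · exact abs_wzCoeff_le n
        · exact pochRatio_le n k
    _ = ((n : ℝ) + 1) * (1 / 2) ^ n * (1 / (2 * k + 1) ^ 3) := by
        field_simp
    _ ≤ _ := by
        gcongr
        linarith [(Nat.cast_nonneg k : (0 : ℝ) ≤ k)]

lemma summable_one_div_succ_cube : Summable fun k : ℕ => 1 / ((k : ℝ) + 1) ^ 3 := by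
  have h := (summable_nat_add_iff 1).2 (Real.summable_one_div_nat_pow.2 (by norm_num : 1 < 3))
  simpa using h

lemma summable_wzF (n : ℕ) : Summable (wzF n) :=
  .of_norm_bounded (summable_one_div_succ_cube.mul_left _) (abs_wzF_le n)

lemma summable_tsum_wzF : Summable fun n => ∑' k, wzF n k := by
  have hg : Summable fun n : ℕ => ((n : ℝ) + 1) * (1 / 2) ^ n := by
    have h₁ := summable_pow_mul_geometric_of_norm_lt_one 1 (r := (1 / 2 : ℝ)) (by norm_num)
    have h₀ := summable_geometric_of_norm_lt_one (x := (1 / 2 : ℝ)) (by norm_num)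
    refine (h₁.add h₀).congr fun n => ?_
    ring
  refine .of_norm_bounded (hg.mul_right (∑' k : ℕ, 1 / ((k : ℝ) + 1) ^ 3)) fun n => ?_
  rw [← tsum_mul_left]
  exact tsum_of_norm_bounded (summable_one_div_succ_cube.mul_left _).hasSum (abs_wzF_le n)

lemma tendsto_wzG (n : ℕ) : Tendsto (wzG n) atTop (𝓝 0) := by
  have hlim := (tendsto_one_div_add_atTop_nhds_zero_nat (𝕜 := ℝ)).const_mul
    (((n : ℝ) + 3) ^ 2 * 10 * |wzCoeff n|)
  rw [mul_zero] at hlim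
  refine squeeze_zero_norm (fun k => ?_) hlim
  have hn : (0 : ℝ) ≤ n := n.cast_nonneg
  have hk : (0 : ℝ) ≤ k := k.cast_nonneg
  have hp := pochRatio_nonneg n k
  have hle : pochRatio n k ≤ 1 / (k + 1) := (pochRatio_le n k).trans (by gcongr; linarith)
  have hcert : |wzCert n k| ≤ ((n : ℝ) + 3) ^ 2 * 10 * (k + 1) ^ 2 := by
    have hnum : (((k : ℝ) + (n + 2) / 2) ^ 2 + 2 * n * ((k : ℝ) + (n + 2) / 2)
        + 5 / 4 * ((n : ℝ) + 1) ^ 2) / (2 * n + 1) ≤ ((n : ℝ) + 3) ^ 2 * 10 * (k + 1) ^ 2 := by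
      refine (div_le_self (by positivity) (by linarith)).trans ?_
      have : (0 : ℝ) ≤ ((n : ℝ) + 3) ^ 2 * 10 * (k + 1) ^ 2 -
        (((k : ℝ) + (n + 2) / 2) ^ 2 + 2 * n * ((k : ℝ) + (n + 2) / 2)
        + 5 / 4 * ((n : ℝ) + 1) ^ 2) := by
        ring_nf
        nlinarith [(by positivity : (0 : ℝ) ≤ n * k), (by positivity : (0 : ℝ) ≤ n ^ 2 * k),
          (by positivity : (0 : ℝ) ≤ n * k ^ 2), (by positivity : (0 : ℝ) ≤ n ^ 2 * k ^ 2)]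
      linarith
    rw [wzCert, abs_le]
    constructor
    · have : (1 : ℝ) ≤ ((n : ℝ) + 3) ^ 2 * 10 * (k + 1) ^ 2 := by
        have h₁ : (1 : ℝ) ≤ ((n : ℝ) + 3) ^ 2 * 10 := by nlinarith
        have h₂ : (1 : ℝ) ≤ ((k : ℝ) + 1) ^ 2 := by nlinarith
        nlinarith
      have : (0 : ℝ) ≤ (((k : ℝ) + (n + 2) / 2) ^ 2 + 2 * n * ((k : ℝ) + (n + 2) / 2)
        + 5 / 4 * ((n : ℝ) + 1) ^ 2) / (2 * n + 1) := by positivity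
      linarith
    · linarith
  rw [wzG, Real.norm_eq_abs, abs_mul, abs_mul,
    abs_of_nonneg (by positivity : 0 ≤ pochRatio n k ^ 4)]
  calc |wzCert n k| * (|wzCoeff n| * pochRatio n k ^ 4)
      ≤ (((n : ℝ) + 3) ^ 2 * 10 * (k + 1) ^ 2) * (|wzCoeff n| * (1 / (k + 1)) ^ 4) := by gcongr
    _ = ((n : ℝ) + 3) ^ 2 * 10 * |wzCoeff n| * (1 / ((k : ℝ) + 1) ^ 2) := by field_simp
    _ ≤ _ := by
      gcongr
      nlinarith

lemma wzG_zero_right (n : ℕ) : wzG n 0 = ∑' k, wzF n k - ∑' k, wzF (n + 1) k := by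
  have h := ((summable_wzF n).hasSum.sub (summable_wzF (n + 1)).hasSum).tendsto_sum_nat
  simp only [wzF_sub_wzF_succ, Finset.sum_range_sub'] at h
  have h' : Tendsto (fun K => wzG n 0 - wzG n K) atTop (𝓝 (wzG n 0 - 0)) :=
    tendsto_const_nhds.sub (tendsto_wzG n)
  rw [sub_zero] at h'
  exact tendsto_nhds_unique h' h

lemma tsum_wzG_zero_right : ∑' n, wzG n 0 = ∑' k, wzF 0 k := by
  have h := summable_tsum_wzF
  simp only [wzG_zero_right]
  rw [h.tsum_sub ((summable_nat_add_iff 1).2 h), h.tsum_eq_zero_add]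
  ring

lemma tsum_wzF_zero_left : ∑' k, wzF 0 k = 7 / 8 * ∑' k : ℕ, 1 / ((k : ℝ) + 1) ^ 3 := by
  have hF (k : ℕ) : wzF 0 k = 1 / (((2 * k : ℕ) : ℝ) + 1) ^ 3 := by
    rw [wzF, pochRatio_zero_left]
    simp only [wzCoeff, Finset.range_zero, Finset.prod_empty]
    push_cast
    have : (2 * k + 1 : ℝ) ≠ 0 := by positivity
    field_simp
    ring
  have hodd (k : ℕ) :
      1 / (((2 * k + 1 : ℕ) : ℝ) + 1) ^ 3 = 1 / 8 * (1 / ((k : ℝ) + 1) ^ 3) := by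
    push_cast
    have : (k + 1 : ℝ) ≠ 0 := by positivity
    rw [show (2 * k + 1 + 1 : ℝ) = 2 * (k + 1) by ring]
    field_simp
    norm_num
  have hsplit := tsum_even_add_odd (f := fun k : ℕ => 1 / ((k : ℝ) + 1) ^ 3)
    ((summable_wzF 0).congr hF)
    ((summable_one_div_succ_cube.mul_left (1 / 8)).congr fun k => (hodd k).symm)
  simp only [hodd, ← hF, tsum_mul_left] at hsplit
  linarith

lemma poch_succ (a : ℝ) (n : ℕ) : poch a (n + 1) = poch a n * (a + n) :=
  Finset.prod_range_succ _ _

lemma poch_pos {a : ℝ} (ha : 0 < a) (n : ℕ) : 0 < poch a n :=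
  Finset.prod_pos fun _ _ => by positivity

lemma factorial_pow_div_poch_pow (n : ℕ) :
    (Nat.factorial (n + 1) : ℝ) ^ 5 * (-(1 / 4 : ℝ)) ^ (n + 1) / poch (1 / 2) (n + 1) ^ 5 =
      -8 * ((n : ℝ) + 1) ^ 5 / (2 * n + 1) * wzCoeff n := by
  induction n with
  | zero => norm_num [poch, wzCoeff]
  | succ n ih =>
    have hp := (poch_pos (by norm_num : (0 : ℝ) < 1 / 2) (n + 1)).ne'
    rw [Nat.factorial_succ (n + 1), poch_succ _ (n + 1), pow_succ _ (n + 1), wzCoeff_succ]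
    push_cast
    have h₁ : (1 / 2 + (n + 1) : ℝ) ≠ 0 := by positivity
    have h₂ : (n : ℝ) + 3 / 2 ≠ 0 := by positivity
    have h₃ : (n : ℝ) + 1 / 2 ≠ 0 := by positivity
    have h₄ : 2 * (n : ℝ) + 1 ≠ 0 := by positivity
    have h₅ : 2 * ((n : ℝ) + 1) + 1 ≠ 0 := by positivity
    calc _ = (Nat.factorial (n + 1) : ℝ) ^ 5 * (-(1 / 4 : ℝ)) ^ (n + 1) / poch (1 / 2) (n + 1) ^ 5
          * (-((n : ℝ) + 1 + 1) ^ 5 / (4 * (1 / 2 + (n + 1)) ^ 5)) := by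
            field_simp
      _ = _ := by
            rw [ih, show (1 / 2 + (n + 1) : ℝ) = n + 3 / 2 by ring,
              show 2 * ((n : ℝ) + 1) + 1 = 2 * (n + 3 / 2) by ring,
              show 2 * (n : ℝ) + 1 = 2 * (n + 1 / 2) by ring]
            field_simp

/-- Guillera's identity:
`∑_{n≥1} (10n²−6n+1)/n⁵ · n!⁵(−1/4)ⁿ/[1/2]_n⁵ = −28 ζ(3)`. -/
theorem stmt_0 :
    ∑' n : ℕ,
      (10 * ((n : ℝ) + 1) ^ 2 - 6 * ((n : ℝ) + 1) + 1) / ((n : ℝ) + 1) ^ 5 *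
        (((Nat.factorial (n + 1) : ℝ)) ^ 5 * (-(1 / 4 : ℝ)) ^ (n + 1) /
          (poch (1 / 2) (n + 1)) ^ 5)
      = -28 * ∑' k : ℕ, 1 / ((k : ℝ) + 1) ^ 3 := by
  have hterm (n : ℕ) :
      (10 * ((n : ℝ) + 1) ^ 2 - 6 * ((n : ℝ) + 1) + 1) / ((n : ℝ) + 1) ^ 5 *
        (((Nat.factorial (n + 1) : ℝ)) ^ 5 * (-(1 / 4 : ℝ)) ^ (n + 1) /
          (poch (1 / 2) (n + 1)) ^ 5) = -32 * wzG n 0 := by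
    rw [factorial_pow_div_poch_pow]
    simp only [wzG, wzCert, pochRatio, Finset.range_zero, Finset.prod_empty]
    push_cast
    have h₁ : (n : ℝ) + 1 ≠ 0 := by positivity
    have h₂ : 2 * (n : ℝ) + 1 ≠ 0 := by positivity
    field_simp
    ring
  simp only [hterm]
  rw [tsum_mul_left, tsum_wzG_zero_right, tsum_wzF_zero_left]
  ring
end

section
/- The identity ∑_{n=1}^∞ (5532n⁴ − 5600n³ + 2275n² − 425n + 30)/n⁹ · (n!)⁹(−1024/3125)ⁿ / ([1/2]_n⁵ · [1/5]_n · [2/5]_n · [3/5]_n · [4/5]_n) = −380928ζ(5) holds. -/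
namespace QuinticZeta

/-- Numerator of the rational certificate. -/
noncomputable def certNum (n u : ℂ) : ℂ :=
  (84 * n ^ 4 + 70 * n ^ 5 - 2973 * n ^ 6 - 5459 / 2 * n ^ 7 + 32538 * n ^ 8 + 30012 * n ^ 9
      - 129540 * n ^ 10 + 5119 / 2 * n ^ 11 + 158763 * n ^ 12 - 110912 * n ^ 13 + 22128 * n ^ 14)
    + (72 * n ^ 2 - 212 * n ^ 3 - 3654 * n ^ 4 + 7091 * n ^ 5 + 26500 * n ^ 6 - 76428 * n ^ 7
      + 18856 * n ^ 8 - 237325 * n ^ 9 - 214490 * n ^ 10 + 512578 * n ^ 11 - 205500 * n ^ 12) * u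
    + (-12 - 2 * n - 213 * n ^ 2 + 1201 / 2 * n ^ 3 + 1882 * n ^ 4 + 50892 * n ^ 5
      - 145840 * n ^ 6 + 544163 / 2 * n ^ 7 + 369047 * n ^ 8 - 294668 * n ^ 9
      + 595320 * n ^ 10) * u ^ 2
    + (108 + 510 * n + 352 * n ^ 2 - 9852 * n ^ 3 + 68960 * n ^ 4 - 162500 * n ^ 5
      - 95064 * n ^ 6 + 71258 * n ^ 7 - 565260 * n ^ 8) * u ^ 3
    + (-288 - 2544 * n - 6992 * n ^ 2 + 29728 * n ^ 3 - 42544 * n ^ 4 + 21392 * n ^ 5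
      + 230880 * n ^ 6) * u ^ 4
    + (192 + 2144 * n + 8320 * n ^ 2 - 13024 * n ^ 3 - 30912 * n ^ 4) * u ^ 5

set_option maxHeartbeats 4000000 in
theorem certNum_identity (n s : ℂ) :
    -128 * n ^ 3 * (n + 1) ^ 3 * (2 * n + 1) *
        (2 * s * (s ^ 2 - (2 * n + 1) ^ 2) * (4 * s ^ 2 - (n - 1) ^ 2) * (4 * s ^ 2 - (n - 2) ^ 2)) *
        ((s ^ 2 - (2 * n - 1) ^ 2) * (s ^ 2 - (2 * n) ^ 2) * (4 * s ^ 2 - (n - 3) ^ 2))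
      - (2 * n - 1) * (2 * n + 1) * (5 * n) * (5 * n - 1) * (5 * n + 1) * (5 * n + 2) * (5 * n + 3) *
        (2 * s * (s ^ 2 - (2 * n - 1) ^ 2) * (4 * s ^ 2 - (n - 2) ^ 2) * (4 * s ^ 2 - (n - 3) ^ 2)) *
        (s ^ 2 - (n + 1 / 2) ^ 2) ^ 3
    = certNum n ((s + 1 / 2) ^ 2) * ((s + 2 * n - 1) * (2 * s + n - 2) * (2 * s + n - 3)) *
        (s - n - 1 / 2) ^ 3
      - certNum n ((s - 1 / 2) ^ 2) * ((s - 2 * n + 1) * (2 * s - n + 2) * (2 * s - n + 3)) *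
        (s + n + 1 / 2) ^ 3 := by
  unfold certNum
  ring

/-- Denominator of the rational certificate. -/
noncomputable def certDen (n : ℂ) : ℂ :=
  (2 * n - 1) * (2 * n + 1) * (5 * n) * (5 * n - 1) * (5 * n + 1) * (5 * n + 2) * (5 * n + 3)

/-- Ratio of consecutive weights. -/
noncomputable def weightRatio (n : ℂ) : ℂ := -128 * n ^ 3 * (n + 1) ^ 3 * (2 * n + 1) / certDen n

/-- The coefficients of the companion sum, as functions of `u`. -/
noncomputable def beta : ℕ → ℂ → ℂ
  | 0, u => -2097152 / 670044375 *
      ((u - 9 / 4) * (u - 25 / 4) * (u - 49 / 4) * (u - 81 / 4) * (u - 121 / 4) * (u - 169 / 4)) /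
        ((u - 1) * (u - 4) * (u - 9) * (u - 16)) ^ 3
  | m + 1, u => beta m u * (weightRatio (m + 4) *
      ((u - (2 * (m + 4) - 1 / 2) ^ 2) * (u - (2 * (m + 4) + 1 / 2) ^ 2) *
        (4 * u - ((m + 4 : ℂ) - 2) ^ 2)) / (u - (m + 4 + 1) ^ 2) ^ 3)

/-- The common factor of the summands in `s`. -/
noncomputable def core : ℕ → ℂ → ℂ
  | 0, s => -524288 / 670044375 * (s ^ 2 * ((s ^ 2 - 1) * (s ^ 2 - 4) * (s ^ 2 - 9) * (s ^ 2 - 16) *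
      (s ^ 2 - 25) * (s ^ 2 - 36))) /
        ((s ^ 2 - 1 / 4) * (s ^ 2 - 9 / 4) * (s ^ 2 - 25 / 4) * (s ^ 2 - 49 / 4)) ^ 3
  | m + 1, s => core m s * (weightRatio (m + 4) *
      ((s ^ 2 - (2 * (m + 4) - 1) ^ 2) * (s ^ 2 - (2 * (m + 4)) ^ 2) *
        (4 * s ^ 2 - ((m + 4 : ℂ) - 3) ^ 2)) / (s ^ 2 - (m + 4 + 1 / 2) ^ 2) ^ 3)

/-- The summand in `s` of the certificate recurrence. -/
noncomputable def summand (m : ℕ) (s : ℂ) : ℂ :=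
  core m s * (2 * s * (s ^ 2 - (2 * (m + 4) - 1) ^ 2) * (4 * s ^ 2 - ((m + 4 : ℂ) - 2) ^ 2) *
    (4 * s ^ 2 - ((m + 4 : ℂ) - 3) ^ 2))

/-- The companion summand in `u` of the certificate recurrence. -/
noncomputable def companion (m : ℕ) (u : ℂ) : ℂ :=
  (u - 1 / 4) ^ 2 * beta m u * certNum (m + 4) u / certDen (m + 4)

theorem core_neg (m : ℕ) (s : ℂ) : core m (-s) = core m s := by
  induction m with
  | zero => simp [core]
  | succ m ih => simp [core, ih]

theorem certDen_ne_zero (m : ℕ) : certDen (m + 4) ≠ 0 := by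
  have h : ∀ a b : ℕ, (a * (m : ℂ) + b + 1) ≠ 0 := fun a b => by
    exact_mod_cast Nat.succ_ne_zero (a * m + b)
  have e : certDen (m + 4) = (2 * m + (6 : ℕ) + 1) * (2 * m + (8 : ℕ) + 1) *
      (5 * m + (19 : ℕ) + 1) * (5 * m + (18 : ℕ) + 1) * (5 * m + (20 : ℕ) + 1) *
      (5 * m + (21 : ℕ) + 1) * (5 * m + (22 : ℕ) + 1) := by
    unfold certDen; push_cast; ring
  rw [e]
  have h2 := fun b => h 2 b
  have h5 := fun b => h 5 b
  push_cast at h2 h5 ⊢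
  simp only [mul_ne_zero_iff]
  refine ⟨⟨⟨⟨⟨⟨h2 6, h2 8⟩, h5 19⟩, h5 18⟩, h5 20⟩, h5 21⟩, h5 22⟩

/-- `s` is not a half-integer. -/
def NotHalf (s : ℂ) : Prop := ∀ j : ℕ, s ^ 2 ≠ (j + 1 / 2) ^ 2

theorem NotHalf.neg {s : ℂ} (h : NotHalf s) : NotHalf (-s) := fun j => by simpa using h j

theorem NotHalf.ne {s : ℂ} (h : NotHalf s) (j : ℕ) : s - (j + 1 / 2) ≠ 0 ∧ s + (j + 1 / 2) ≠ 0 := by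
  have := sub_ne_zero.2 (h j)
  rw [sq_sub_sq] at this
  exact ⟨right_ne_zero_of_mul this, left_ne_zero_of_mul this⟩

theorem beta_core {s : ℂ} (h : NotHalf s) (m : ℕ) :
    (s - (m + 4) - 1 / 2) ^ 3 * (((s - 1 / 2) ^ 2 - 1 / 4) ^ 2 * beta m ((s - 1 / 2) ^ 2)) =
      (s - 1 / 2) ^ 2 * core m s *
        ((s - 2 * (m + 4) + 1) * (2 * s - (m + 4) + 2) * (2 * s - (m + 4) + 3)) := by
  induction m with
  | zero =>
    have h0 := h.ne 0
    have h1 := h.ne 1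
    have h2 := h.ne 2
    have h3 := h.ne 3
    have h4 := h.ne 4
    norm_num at h0 h1 h2 h3 h4
    obtain ⟨a0, b0⟩ := h0
    obtain ⟨a1, b1⟩ := h1
    obtain ⟨a2, b2⟩ := h2
    obtain ⟨a3, b3⟩ := h3
    obtain ⟨a4, b4⟩ := h4
    have key : (s - 1 / 2) * ((((s - 1 / 2) ^ 2 - 1 / 4) ^ 2) * (-2097152 / 670044375 *
        (((s - 1 / 2) ^ 2 - 9 / 4) * ((s - 1 / 2) ^ 2 - 25 / 4) * ((s - 1 / 2) ^ 2 - 49 / 4) *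
          ((s - 1 / 2) ^ 2 - 81 / 4) * ((s - 1 / 2) ^ 2 - 121 / 4) * ((s - 1 / 2) ^ 2 - 169 / 4)))) =
        -524288 / 670044375 * (s ^ 2 * ((s ^ 2 - 1) * (s ^ 2 - 4) * (s ^ 2 - 9) * (s ^ 2 - 16) *
      (s ^ 2 - 25) * (s ^ 2 - 36))) * ((s - 7) * (2 * s - 2) * (2 * s - 1)) := by
      ring
    simp only [beta, core]
    have e1 : (((s - 1 / 2) ^ 2 - 1) * ((s - 1 / 2) ^ 2 - 4) * ((s - 1 / 2) ^ 2 - 9) *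
        ((s - 1 / 2) ^ 2 - 16)) = (s - 9 / 2) * ((s + 1 / 2) * (s - 3 / 2) * (s + 3 / 2) *
        (s - 5 / 2) * (s + 5 / 2) * (s - 7 / 2) * (s + 7 / 2)) := by ring
    have e2 : ((s ^ 2 - 1 / 4) * (s ^ 2 - 9 / 4) * (s ^ 2 - 25 / 4) * (s ^ 2 - 49 / 4)) =
        (s - 1 / 2) * ((s + 1 / 2) * (s - 3 / 2) * (s + 3 / 2) *
        (s - 5 / 2) * (s + 5 / 2) * (s - 7 / 2) * (s + 7 / 2)) := by ring
    have hW : ((s + 1 / 2) * (s - 3 / 2) * (s + 3 / 2) *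
        (s - 5 / 2) * (s + 5 / 2) * (s - 7 / 2) * (s + 7 / 2)) ≠ 0 := by
      simp only [mul_ne_zero_iff]; exact ⟨⟨⟨⟨⟨⟨b0, a1⟩, b1⟩, a2⟩, b2⟩, a3⟩, b3⟩
    rw [e1, e2]
    generalize ((s + 1 / 2) * (s - 3 / 2) * (s + 3 / 2) *
        (s - 5 / 2) * (s + 5 / 2) * (s - 7 / 2) * (s + 7 / 2)) = W at *
    rw [show s - ((0 : ℕ) + 4) - 1 / 2 = s - 9 / 2 by push_cast; ring,
      show s - 2 * ((0 : ℕ) + 4) + 1 = s - 7 by push_cast; ring,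
      show 2 * s - ((0 : ℕ) + 4) + 2 = 2 * s - 2 by push_cast; ring,
      show 2 * s - ((0 : ℕ) + 4) + 3 = 2 * s - 1 by push_cast; ring]
    generalize -2097152 / 670044375 *
        (((s - 1 / 2) ^ 2 - 9 / 4) * ((s - 1 / 2) ^ 2 - 25 / 4) * ((s - 1 / 2) ^ 2 - 49 / 4) *
          ((s - 1 / 2) ^ 2 - 81 / 4) * ((s - 1 / 2) ^ 2 - 121 / 4) *
          ((s - 1 / 2) ^ 2 - 169 / 4)) = N at *
    generalize -524288 / 670044375 * (s ^ 2 * ((s ^ 2 - 1) * (s ^ 2 - 4) * (s ^ 2 - 9) *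
      (s ^ 2 - 16) * (s ^ 2 - 25) * (s ^ 2 - 36))) = M at *
    generalize ((s - 1 / 2) ^ 2 - 1 / 4) ^ 2 = L at *
    generalize (s - 7) * (2 * s - 2) * (2 * s - 1) = K at *
    generalize s - 9 / 2 = I at *
    generalize s - 1 / 2 = A at *
    rw [mul_pow, mul_pow]
    have : I ^ 3 ≠ 0 := pow_ne_zero _ a4
    have : A ^ 3 ≠ 0 := pow_ne_zero _ a0
    have : W ^ 3 ≠ 0 := pow_ne_zero _ hW
    field_simp
    linear_combination key
  | succ m ih =>
    obtain ⟨a, b⟩ := h.ne (m + 4)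
    obtain ⟨c, d⟩ := h.ne (m + 5)
    rw [beta, core]
    push_cast at a b c d ⊢
    have e1 : ((s - 1 / 2) ^ 2 - (m + 4 + 1) ^ 2 : ℂ) = (s - (m + 5 + 1 / 2)) * (s + (m + 4 + 1 / 2)) := by
      ring
    have e2 : (s ^ 2 - (m + 4 + 1 / 2) ^ 2 : ℂ) = (s - (m + 4 + 1 / 2)) * (s + (m + 4 + 1 / 2)) := by
      ring
    have e3 : s - (m + 4) - 1 / 2 = s - (m + 4 + 1 / 2) := by ring
    have e4 : s - (m + 1 + 4) - 1 / 2 = s - (m + 5 + 1 / 2) := by ring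
    rw [e3] at ih
    rw [e1, e2, e4]
    generalize hX : s - (m + 4 + 1 / 2) = X at *
    generalize hY : s + (m + 4 + 1 / 2) = Y at *
    generalize hZ : s - (m + 5 + 1 / 2) = Z at *
    rw [mul_pow, mul_pow]
    have : X ^ 3 ≠ 0 := pow_ne_zero _ a
    have : Y ^ 3 ≠ 0 := pow_ne_zero _ b
    have : Z ^ 3 ≠ 0 := pow_ne_zero _ c
    generalize weightRatio (m + 4) = w
    generalize beta m ((s - 1 / 2) ^ 2) = be at *
    generalize core m s = co at *
    field_simp
    linear_combination 2 ^ 14 * w * ((s - 2 * (m + 4)) * (s + 2 * (m + 4) - 1) *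
      (s - 2 * (m + 4) - 1) * (s + 2 * (m + 4)) * (2 * s - (m + 4) + 1) * (2 * s + (m + 4) - 3)) * ih

theorem companion_core {s : ℂ} (h : NotHalf s) (m : ℕ) :
    companion m ((s - 1 / 2) ^ 2) / (s - 1 / 2) ^ 2 =
      core m s * ((s - 2 * (m + 4) + 1) * (2 * s - (m + 4) + 2) * (2 * s - (m + 4) + 3)) *
        certNum (m + 4) ((s - 1 / 2) ^ 2) / (certDen (m + 4) * (s - (m + 4) - 1 / 2) ^ 3) := by
  have h0 := (h.ne 0).1
  have h4 := (h.ne (m + 4)).1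
  have hd := certDen_ne_zero m
  push_cast at h0 h4
  rw [zero_add] at h0
  rw [← sub_sub] at h4
  have hb := beta_core h m
  rw [companion, div_div, div_eq_div_iff (mul_ne_zero hd (pow_ne_zero _ h0))
    (mul_ne_zero hd (pow_ne_zero _ h4))]
  linear_combination certDen (m + 4) * certNum (m + 4) ((s - 1 / 2) ^ 2) * hb

theorem companion_core' {s : ℂ} (h : NotHalf s) (m : ℕ) :
    companion m ((s + 1 / 2) ^ 2) / (s + 1 / 2) ^ 2 =
      core m s * ((s + 2 * (m + 4) - 1) * (2 * s + (m + 4) - 2) * (2 * s + (m + 4) - 3)) *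
        certNum (m + 4) ((s + 1 / 2) ^ 2) / (certDen (m + 4) * (s + (m + 4) + 1 / 2) ^ 3) := by
  have := companion_core h.neg m
  rw [core_neg, show (-s - 1 / 2) ^ 2 = (s + 1 / 2) ^ 2 by ring] at this
  rw [this, ← neg_div_neg_eq]
  congr 1 <;> ring

theorem summand_succ_sub {s : ℂ} (h : NotHalf s) (m : ℕ) :
    summand (m + 1) s - summand m s =
      companion m ((s + 1 / 2) ^ 2) / (s + 1 / 2) ^ 2 -
        companion m ((s - 1 / 2) ^ 2) / (s - 1 / 2) ^ 2 := by
  obtain ⟨ha, hb⟩ := h.ne (m + 4)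
  have hd := certDen_ne_zero m
  push_cast at ha hb
  rw [← sub_sub] at ha
  rw [← add_assoc] at hb
  rw [companion_core h, companion_core' h, summand, summand, core, weightRatio]
  have key := certNum_identity (m + 4) s
  rw [show s ^ 2 - (m + 4 + 1 / 2 : ℂ) ^ 2 = (s - (m + 4) - 1 / 2) * (s + (m + 4) + 1 / 2) by ring]
    at key ⊢
  change _ - certDen (m + 4) * _ * _ = _ at key
  push_cast
  generalize certNum (m + 4) ((s + 1 / 2) ^ 2) = c₁ at *
  generalize certNum (m + 4) ((s - 1 / 2) ^ 2) = c₂ at *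
  generalize certDen (m + 4) = d at *
  generalize core m s = co at *
  generalize s - (m + 4) - 1 / 2 = X at *
  generalize s + (m + 4) + 1 / 2 = Y at *
  have : X ^ 3 ≠ 0 := pow_ne_zero _ ha
  have : Y ^ 3 ≠ 0 := pow_ne_zero _ hb
  rw [mul_pow] at *
  field_simp
  linear_combination co * key

/-- Numerator of the initial part of the companion sum. -/
noncomputable def headNum (u : ℂ) : ℂ :=
  (-1334762990316000 + 7217743180681440 * u - 9254728385746578 * u ^ 2 + 8020936148106255 * u ^ 3
    - 4631506328917943 * u ^ 4 + 1638601202562870 * u ^ 5 - 373141164191928 * u ^ 6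
    + 55609176849235 * u ^ 7 - 5189086867503 * u ^ 8 + 272191480200 * u ^ 9
    - 6088280048 * u ^ 10) / 32162130000

/-- The initial part of the companion sum. -/
noncomputable def head (u : ℂ) : ℂ := headNum u / ((u - 1) * (u - 4) * (u - 9)) ^ 3

/-- The summand in `s` at which the recurrence starts. -/
noncomputable def base (s : ℂ) : ℂ := s * (s ^ 2 - 1) / (s ^ 2 - 1 / 4) ^ 3

set_option maxHeartbeats 4000000 in
theorem headNum_identity (s : ℂ) :
    -524288 / 670044375 * (s ^ 2 * ((s ^ 2 - 1) * (s ^ 2 - 4) * (s ^ 2 - 9) * (s ^ 2 - 16) *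
      (s ^ 2 - 25) * (s ^ 2 - 36))) * (2 * s * (s ^ 2 - 49) * (4 * s ^ 2 - 4) * (4 * s ^ 2 - 1))
      - s * (s ^ 2 - 1) * ((s ^ 2 - 9 / 4) * (s ^ 2 - 25 / 4) * (s ^ 2 - 49 / 4)) ^ 3 =
    headNum ((s + 1 / 2) ^ 2) * (s + 1 / 2) * (s - 7 / 2) ^ 3 -
      headNum ((s - 1 / 2) ^ 2) * (s - 1 / 2) * (s + 7 / 2) ^ 3 := by
  unfold headNum
  ring

theorem head_neg_form {s : ℂ} (h : NotHalf s) :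
    head ((s - 1 / 2) ^ 2) / (s - 1 / 2) ^ 2 =
      headNum ((s - 1 / 2) ^ 2) * (s - 1 / 2) * (s + 7 / 2) ^ 3 /
        ((s ^ 2 - 1 / 4) * (s ^ 2 - 9 / 4) * (s ^ 2 - 25 / 4) * (s ^ 2 - 49 / 4)) ^ 3 := by
  have h0 := h.ne 0
  have h1 := h.ne 1
  have h2 := h.ne 2
  have h3 := h.ne 3
  norm_num at h0 h1 h2 h3
  obtain ⟨a0, b0⟩ := h0
  obtain ⟨a1, b1⟩ := h1
  obtain ⟨a2, b2⟩ := h2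
  obtain ⟨a3, b3⟩ := h3
  have hW : (s + 1 / 2) * (s - 3 / 2) * (s + 3 / 2) * (s - 5 / 2) * (s + 5 / 2) * (s - 7 / 2) ≠ 0 := by
    simp only [mul_ne_zero_iff]; exact ⟨⟨⟨⟨⟨b0, a1⟩, b1⟩, a2⟩, b2⟩, a3⟩
  rw [head, show ((s - 1 / 2) ^ 2 - 1) * ((s - 1 / 2) ^ 2 - 4) * ((s - 1 / 2) ^ 2 - 9) =
      (s + 1 / 2) * (s - 3 / 2) * (s + 3 / 2) * (s - 5 / 2) * (s + 5 / 2) * (s - 7 / 2) by ring,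
    show (s ^ 2 - 1 / 4) * (s ^ 2 - 9 / 4) * (s ^ 2 - 25 / 4) * (s ^ 2 - 49 / 4) =
      (s - 1 / 2) * (s + 7 / 2) * ((s + 1 / 2) * (s - 3 / 2) * (s + 3 / 2) * (s - 5 / 2) *
        (s + 5 / 2) * (s - 7 / 2)) by ring]
  generalize (s + 1 / 2) * (s - 3 / 2) * (s + 3 / 2) * (s - 5 / 2) * (s + 5 / 2) * (s - 7 / 2) = W at *
  generalize headNum ((s - 1 / 2) ^ 2) = N
  generalize s - 1 / 2 = A at *
  generalize s + 7 / 2 = B at *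
  field_simp

theorem head_pos_form {s : ℂ} (h : NotHalf s) :
    head ((s + 1 / 2) ^ 2) / (s + 1 / 2) ^ 2 =
      headNum ((s + 1 / 2) ^ 2) * (s + 1 / 2) * (s - 7 / 2) ^ 3 /
        ((s ^ 2 - 1 / 4) * (s ^ 2 - 9 / 4) * (s ^ 2 - 25 / 4) * (s ^ 2 - 49 / 4)) ^ 3 := by
  have := head_neg_form h.neg
  rw [show (-s - 1 / 2) ^ 2 = (s + 1 / 2) ^ 2 by ring, neg_sq] at this
  rw [this]
  congr 1
  ring

theorem summand_zero_sub_base {s : ℂ} (h : NotHalf s) :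
    summand 0 s - base s =
      head ((s + 1 / 2) ^ 2) / (s + 1 / 2) ^ 2 - head ((s - 1 / 2) ^ 2) / (s - 1 / 2) ^ 2 := by
  have h0 := sub_ne_zero.2 (h 0)
  have h1 := sub_ne_zero.2 (h 1)
  have h2 := sub_ne_zero.2 (h 2)
  have h3 := sub_ne_zero.2 (h 3)
  norm_num at h0 h1 h2 h3
  rw [head_neg_form h, head_pos_form h, ← sub_div, ← headNum_identity, summand, core, base]
  norm_num
  generalize s ^ 2 - 1 / 4 = A at *
  generalize s ^ 2 - 9 / 4 = B at *
  generalize s ^ 2 - 25 / 4 = C at *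
  generalize s ^ 2 - 49 / 4 = D at *
  field_simp

/-- Points of the `u`-plane at which the companion terms are estimated. -/
def Good (u : ℂ) : Prop := u.re ≤ 9 / 16 ∨ ∃ K : ℕ, 2 ≤ K ∧ u = (K - 1 / 2) ^ 2

theorem Good.sub_natCast_sq {u : ℂ} (h : Good u) (j : ℕ) : 1 / 4 ≤ ‖u - (j + 1) ^ 2‖ := by
  rcases h with h | ⟨K, hK, rfl⟩
  · refine le_trans ?_ (Complex.abs_re_le_norm _)
    have e : (u - ((j : ℂ) + 1) ^ 2).re = u.re - ((j : ℝ) + 1) ^ 2 := by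
      rw [Complex.sub_re, ← Complex.ofReal_natCast, ← Complex.ofReal_one, ← Complex.ofReal_add,
        ← Complex.ofReal_pow, Complex.ofReal_re]
    rw [e, le_abs]
    right
    have : (0 : ℝ) ≤ j := j.cast_nonneg
    nlinarith
  · have e : ((K : ℂ) - 1 / 2) ^ 2 - (j + 1) ^ 2 =
        (((K - 1 / 2 - (j + 1)) * (K - 1 / 2 + (j + 1)) : ℝ) : ℂ) := by
      push_cast; ring
    rw [e, Complex.norm_real, Real.norm_eq_abs, abs_mul]
    have h1 : (1 / 2 : ℝ) ≤ |(K : ℝ) - 1 / 2 - (j + 1)| := by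
      rw [le_abs]
      rcases le_or_gt K (j + 1) with h | h
      · right
        have : (K : ℝ) ≤ j + 1 := by exact_mod_cast h
        linarith
      · left
        have : (j : ℝ) + 1 + 1 ≤ K := by exact_mod_cast h
        linarith
    have h2 : (1 / 2 : ℝ) ≤ |(K : ℝ) - 1 / 2 + (j + 1)| := by
      rw [le_abs]
      left
      have : (2 : ℝ) ≤ K := by exact_mod_cast hK
      have : (0 : ℝ) ≤ j := j.cast_nonneg
      linarith
    nlinarith

theorem norm_sub_le_mul {u a b : ℂ} {C : ℝ} (h : 1 / 4 ≤ ‖u - b‖) (hC : 1 + 4 * ‖b - a‖ ≤ C) :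
    ‖u - a‖ ≤ C * ‖u - b‖ := by
  have : ‖u - a‖ ≤ ‖u - b‖ + ‖b - a‖ := by simpa using norm_add_le (u - b) (b - a)
  nlinarith [norm_nonneg (b - a), norm_nonneg (u - b)]

theorem one_add_norm_le_mul {u b : ℂ} {C : ℝ} (h : 1 / 4 ≤ ‖u - b‖) (hC : 5 + 4 * ‖b‖ ≤ C) :
    1 + ‖u‖ ≤ C * ‖u - b‖ := by
  have : ‖u‖ ≤ ‖u - b‖ + ‖b‖ := by simpa using norm_add_le (u - b) b
  nlinarith [norm_nonneg b, norm_nonneg (u - b)]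

theorem beta_zero_bound {u : ℂ} (h : Good u) : ‖beta 0 u‖ * (1 + ‖u‖) ^ 6 ≤ 200 ^ 12 := by
  have h1 := h.sub_natCast_sq 0
  have h2 := h.sub_natCast_sq 1
  have h3 := h.sub_natCast_sq 2
  have h4 := h.sub_natCast_sq 3
  norm_num at h1 h2 h3 h4
  have a1 : ‖u - 9 / 4‖ ≤ 200 * ‖u - 1‖ := norm_sub_le_mul (by linarith) (by norm_num)
  have a2 : ‖u - 25 / 4‖ ≤ 200 * ‖u - 1‖ := norm_sub_le_mul (by linarith) (by norm_num)
  have a3 : ‖u - 49 / 4‖ ≤ 200 * ‖u - 1‖ := norm_sub_le_mul (by linarith) (by norm_num)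
  have a4 : ‖u - 81 / 4‖ ≤ 200 * ‖u - 4‖ := norm_sub_le_mul (by linarith) (by norm_num)
  have a5 : ‖u - 121 / 4‖ ≤ 200 * ‖u - 4‖ := norm_sub_le_mul (by linarith) (by norm_num)
  have a6 : ‖u - 169 / 4‖ ≤ 200 * ‖u - 4‖ := norm_sub_le_mul (by linarith) (by norm_num)
  have a7 : 1 + ‖u‖ ≤ 200 * ‖u - 9‖ := one_add_norm_le_mul (by linarith) (by norm_num)
  have a8 : 1 + ‖u‖ ≤ 200 * ‖u - 16‖ := one_add_norm_le_mul (by linarith) (by norm_num)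
  have hpos : 0 < (‖u - 1‖ * ‖u - 4‖ * ‖u - 9‖ * ‖u - 16‖) ^ 3 := by positivity
  rw [beta, norm_div, div_mul_eq_mul_div]
  simp only [norm_mul, norm_pow]
  rw [div_le_iff₀ hpos]
  have hc : ‖(-2097152 / 670044375 : ℂ)‖ ≤ 1 := by norm_num
  calc _ = ‖(-2097152 / 670044375 : ℂ)‖ * (‖u - 9 / 4‖ * ‖u - 25 / 4‖ * ‖u - 49 / 4‖ *
        ‖u - 81 / 4‖ * ‖u - 121 / 4‖ * ‖u - 169 / 4‖) * ((1 + ‖u‖) ^ 3 * (1 + ‖u‖) ^ 3) := by ring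
    _ ≤ 1 * ((200 * ‖u - 1‖) * (200 * ‖u - 1‖) * (200 * ‖u - 1‖) * (200 * ‖u - 4‖) *
        (200 * ‖u - 4‖) * (200 * ‖u - 4‖)) * ((200 * ‖u - 9‖) ^ 3 * (200 * ‖u - 16‖) ^ 3) := by
      gcongr
    _ = _ := by ring

theorem norm_factors_le_of_re_le {n : ℝ} (hn : 4 ≤ n) {u : ℂ} (hu : u.re ≤ 9 / 16) :
    ‖u - (2 * n - 1 / 2) ^ 2‖ ≤ 4 * ‖u - (n + 1) ^ 2‖ ∧
    ‖u - (2 * n + 1 / 2) ^ 2‖ ≤ 4 * ‖u - (n + 1) ^ 2‖ ∧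
    ‖4 * u - (n - 2) ^ 2‖ ≤ 4 * ‖u - (n + 1) ^ 2‖ := by
  obtain ⟨X, rfl⟩ : ∃ X : ℂ, u = (n + 1) ^ 2 - X := ⟨(n + 1) ^ 2 - u, by ring⟩
  have hX : (n + 1) ^ 2 - 9 / 16 ≤ X.re := by
    have : ((n : ℂ) + 1) ^ 2 = (((n + 1) ^ 2 : ℝ) : ℂ) := by push_cast; ring
    rw [this, Complex.sub_re, Complex.ofReal_re] at hu
    linarith
  have hXn := Complex.re_le_norm X
  have e0 : ((n : ℂ) + 1) ^ 2 - X - (n + 1) ^ 2 = -X := by ring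
  rw [e0, norm_neg]
  refine ⟨?_, ?_, ?_⟩
  · rw [show ((n : ℂ) + 1) ^ 2 - X - (2 * n - 1 / 2) ^ 2 = -(X + ((3 * n ^ 2 - 4 * n - 3 / 4 : ℝ) : ℂ)) by
      push_cast; ring, norm_neg]
    refine (norm_add_le _ _).trans ?_
    rw [Complex.norm_real, Real.norm_eq_abs, abs_of_nonneg (by nlinarith)]
    nlinarith
  · rw [show ((n : ℂ) + 1) ^ 2 - X - (2 * n + 1 / 2) ^ 2 = -(X + ((3 * n ^ 2 - 3 / 4 : ℝ) : ℂ)) by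
      push_cast; ring, norm_neg]
    refine (norm_add_le _ _).trans ?_
    rw [Complex.norm_real, Real.norm_eq_abs, abs_of_nonneg (by nlinarith)]
    nlinarith
  · rw [show 4 * (((n : ℂ) + 1) ^ 2 - X) - (n - 2) ^ 2 = -(4 * X - ((3 * n ^ 2 + 12 * n : ℝ) : ℂ)) by
      push_cast; ring, norm_neg]
    have h₁ : 0 ≤ 3 * n ^ 2 + 12 * n := by positivity
    have h₂ : 3 * n ^ 2 + 12 * n ≤ 8 * X.re := by nlinarith
    generalize 3 * n ^ 2 + 12 * n = c at *
    refine (sq_le_sq₀ (norm_nonneg _) (by positivity)).1 ?_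
    rw [mul_pow, Complex.sq_norm, Complex.sq_norm, Complex.normSq_apply, Complex.normSq_apply]
    simp
    nlinarith [mul_nonneg h₁ (sub_nonneg.2 h₂)]

theorem norm_pair_le_of_re_le {n : ℝ} (hn : 40 ≤ n) {u : ℂ} (hu : u.re ≤ 9 / 16) :
    ‖(u - (2 * n - 1 / 2) ^ 2) * (4 * u - (n - 2) ^ 2)‖ ≤ 9 * ‖u - (n + 1) ^ 2‖ ^ 2 := by
  obtain ⟨X, rfl⟩ : ∃ X : ℂ, u = (n + 1) ^ 2 - X := ⟨(n + 1) ^ 2 - u, by ring⟩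
  have hX : (n + 1) ^ 2 - 9 / 16 ≤ X.re := by
    have : ((n : ℂ) + 1) ^ 2 = (((n + 1) ^ 2 : ℝ) : ℂ) := by push_cast; ring
    rw [this, Complex.sub_re, Complex.ofReal_re] at hu
    linarith
  have e0 : ((n : ℂ) + 1) ^ 2 - X - (n + 1) ^ 2 = -X := by ring
  rw [e0, norm_neg]
  have e : (((n : ℂ) + 1) ^ 2 - X - (2 * n - 1 / 2) ^ 2) * (4 * (((n : ℂ) + 1) ^ 2 - X) - (n - 2) ^ 2) =
      4 * X ^ 2 + (((9 * n ^ 2 - 28 * n - 3 : ℝ) : ℂ) * X -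
        (((3 * n ^ 2 - 4 * n - 3 / 4) * (3 * n ^ 2 + 12 * n) : ℝ) : ℂ)) := by
    push_cast; ring
  have hq : 0 ≤ 9 * n ^ 2 - 28 * n - 3 := by nlinarith
  have hp : 0 ≤ 3 * n ^ 2 - 4 * n - 3 / 4 := by nlinarith
  have hP : 0 ≤ (3 * n ^ 2 - 4 * n - 3 / 4) * (3 * n ^ 2 + 12 * n) := by positivity
  have hK : (9 * n ^ 2 - 28 * n - 3) ^ 4 ≤ 100 * (2 * (9 * n ^ 2 - 28 * n - 3) *
      ((3 * n ^ 2 - 4 * n - 3 / 4) * (3 * n ^ 2 + 12 * n)) * ((n + 1) ^ 2 - 9 / 16) -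
      ((3 * n ^ 2 - 4 * n - 3 / 4) * (3 * n ^ 2 + 12 * n)) ^ 2) := by
    obtain ⟨k, rfl⟩ : ∃ k, n = 40 + k := ⟨n - 40, by ring⟩
    have hk : 0 ≤ k := by linarith
    rw [← sub_nonneg]
    ring_nf
    positivity
  generalize 9 * n ^ 2 - 28 * n - 3 = q at *
  generalize (3 * n ^ 2 - 4 * n - 3 / 4) * (3 * n ^ 2 + 12 * n) = P at *
  generalize (n + 1) ^ 2 - 9 / 16 = h₀ at *
  rw [e]
  refine (norm_add_le _ _).trans ?_
  have h5 : ‖(q : ℂ) * X - (P : ℂ)‖ ≤ 5 * ‖X‖ ^ 2 := by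
    refine (sq_le_sq₀ (norm_nonneg _) (by positivity)).1 ?_
    rw [mul_pow, Complex.sq_norm, Complex.sq_norm, Complex.normSq_apply, Complex.normSq_apply]
    simp
    nlinarith [mul_nonneg (mul_nonneg hq hP) (sub_nonneg.2 hX),
      sq_nonneg (5 * (X.re * X.re + X.im * X.im) - q ^ 2 / 10)]
  rw [norm_mul, norm_pow]
  norm_num
  linarith

theorem beta_eq_zero {m K : ℕ} (h2 : 2 ≤ K) (hK : K ≤ 2 * m + 7) :
    beta m (((K : ℂ) - 1 / 2) ^ 2) = 0 := by
  induction m with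
  | zero => interval_cases K <;> norm_num [beta]
  | succ m ih =>
    rw [beta]
    rcases (show K ≤ 2 * m + 7 ∨ K = 2 * m + 8 ∨ K = 2 * m + 9 by omega) with h | rfl | rfl
    · rw [ih h, zero_mul]
    · push_cast
      rw [show (2 * (m : ℂ) + 8 - 1 / 2) ^ 2 - (2 * (m + 4) - 1 / 2) ^ 2 = 0 by ring]
      simp
    · push_cast
      rw [show (2 * (m : ℂ) + 9 - 1 / 2) ^ 2 - (2 * (m + 4) + 1 / 2) ^ 2 = 0 by ring]
      simp

theorem norm_factors_le_of_natCast {n : ℝ} (hn : 4 ≤ n) {K : ℝ} (hK : 2 * n ≤ K) :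
    ‖((K : ℂ) - 1 / 2) ^ 2 - (2 * n - 1 / 2) ^ 2‖ * ‖((K : ℂ) - 1 / 2) ^ 2 - (2 * n + 1 / 2) ^ 2‖ *
      ‖4 * ((K : ℂ) - 1 / 2) ^ 2 - (n - 2) ^ 2‖ ≤ 36 * ‖((K : ℂ) - 1 / 2) ^ 2 - (n + 1) ^ 2‖ ^ 3 := by
  have cast : ∀ a b c : ℝ, ‖(a : ℂ) * ((K : ℂ) - 1 / 2) ^ 2 - (b * n + c) ^ 2‖ =
      |a * (K - 1 / 2) ^ 2 - (b * n + c) ^ 2| := fun a b c => by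
    rw [← Real.norm_eq_abs, ← Complex.norm_real]; push_cast; rfl
  have c₁ := cast 1 2 (-1 / 2)
  have c₂ := cast 1 2 (1 / 2)
  have c₃ := cast 4 1 (-2)
  have c₄ := cast 1 1 1
  have hu : (2 * n - 1 / 2) ^ 2 ≤ (K - 1 / 2) ^ 2 := by nlinarith
  push_cast at c₁ c₂ c₃ c₄
  simp only [one_mul, neg_div, ← sub_eq_add_neg] at c₁ c₂ c₃ c₄
  rw [c₁, c₂, c₃, c₄]
  generalize (K - 1 / 2) ^ 2 = u at *
  have h₁ : |u - (2 * n - 1 / 2) ^ 2| ≤ |u - (n + 1) ^ 2| := by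
    rw [abs_of_nonneg (by linarith), abs_of_nonneg (by nlinarith)]
    nlinarith
  have h₂ : |u - (2 * n + 1 / 2) ^ 2| ≤ |u - (n + 1) ^ 2| := by
    rw [abs_of_nonneg (a := u - (n + 1) ^ 2) (by nlinarith), abs_le]
    constructor <;> nlinarith
  have h₃ : |4 * u - (n - 2) ^ 2| ≤ 36 * |u - (n + 1) ^ 2| := by
    rw [abs_of_nonneg (a := u - (n + 1) ^ 2) (by nlinarith), abs_le]
    constructor <;> nlinarith
  calc _ ≤ |u - (n + 1) ^ 2| * |u - (n + 1) ^ 2| * (36 * |u - (n + 1) ^ 2|) := by gcongr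
    _ = _ := by ring

theorem norm_beta_succ_le_of_bound {m : ℕ} {u : ℂ} {M : ℝ} (h0 : u - (m + 4 + 1) ^ 2 ≠ 0)
    (h : ‖u - (2 * ((m : ℂ) + 4) - 1 / 2) ^ 2‖ * ‖u - (2 * ((m : ℂ) + 4) + 1 / 2) ^ 2‖ *
      ‖4 * u - (((m : ℂ) + 4) - 2) ^ 2‖ ≤ M * ‖u - ((m : ℂ) + 4 + 1) ^ 2‖ ^ 3) :
    ‖beta (m + 1) u‖ ≤ M * ‖weightRatio (m + 4)‖ * ‖beta m u‖ := by
  have hp : 0 < ‖u - ((m : ℂ) + 4 + 1) ^ 2‖ := norm_pos_iff.2 h0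
  rw [beta, norm_mul, norm_div, norm_mul, norm_mul, norm_mul, norm_pow, mul_comm]
  gcongr
  rw [div_le_iff₀ (by positivity)]
  calc _ ≤ ‖weightRatio (m + 4)‖ * (M * ‖u - ((m : ℂ) + 4 + 1) ^ 2‖ ^ 3) := by gcongr
    _ = _ := by ring

theorem norm_beta_succ_le {u : ℂ} (h : Good u) (m : ℕ) :
    ‖beta (m + 1) u‖ ≤ 64 * ‖weightRatio (m + 4)‖ * ‖beta m u‖ ∧
      (36 ≤ m → ‖beta (m + 1) u‖ ≤ 36 * ‖weightRatio (m + 4)‖ * ‖beta m u‖) := by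
  have h0 : u - ((m : ℂ) + 4 + 1) ^ 2 ≠ 0 := by
    have := h.sub_natCast_sq (m + 4)
    push_cast at this
    exact norm_pos_iff.1 (by linarith)
  rcases h with h | ⟨K, hK, rfl⟩
  · have hm : (4 : ℝ) ≤ (m : ℝ) + 4 := by have : (0 : ℝ) ≤ m := m.cast_nonneg
                                          linarith
    obtain ⟨h₁, h₂, h₃⟩ := norm_factors_le_of_re_le hm h
    push_cast at h₁ h₂ h₃
    refine ⟨norm_beta_succ_le_of_bound h0 ?_, fun h36 => norm_beta_succ_le_of_bound h0 ?_⟩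
    · calc _ ≤ (4 * ‖u - ((m : ℂ) + 4 + 1) ^ 2‖) * (4 * ‖u - ((m : ℂ) + 4 + 1) ^ 2‖) *
          (4 * ‖u - ((m : ℂ) + 4 + 1) ^ 2‖) := by gcongr
        _ = _ := by ring
    · have h36 : (40 : ℝ) ≤ (m : ℝ) + 4 := by
        have : (36 : ℝ) ≤ m := by exact_mod_cast h36
        linarith
      have h₄ := norm_pair_le_of_re_le h36 h
      push_cast at h₄
      rw [norm_mul] at h₄
      calc _ = ‖u - (2 * ((m : ℂ) + 4) + 1 / 2) ^ 2‖ * (‖u - (2 * ((m : ℂ) + 4) - 1 / 2) ^ 2‖ *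
          ‖4 * u - (((m : ℂ) + 4) - 2) ^ 2‖) := by ring
        _ ≤ (4 * ‖u - ((m : ℂ) + 4 + 1) ^ 2‖) * (9 * ‖u - ((m : ℂ) + 4 + 1) ^ 2‖ ^ 2) := by gcongr
        _ = _ := by ring
  · rcases le_or_gt K (2 * m + 7) with hle | hlt
    · rw [beta_eq_zero hK hle, beta_eq_zero hK (by omega : K ≤ 2 * (m + 1) + 7)]
      simp
    · have hK' : 2 * ((m : ℝ) + 4) ≤ (K : ℝ) := by
        have : ((2 * m + 8 : ℕ) : ℝ) ≤ K := by exact_mod_cast hlt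
        push_cast at this
        linarith
      have hm : (4 : ℝ) ≤ (m : ℝ) + 4 := by have : (0 : ℝ) ≤ m := m.cast_nonneg
                                            linarith
      have := norm_factors_le_of_natCast hm hK'
      push_cast at this
      have key := norm_beta_succ_le_of_bound h0 this
      refine ⟨key.trans ?_, fun _ => key⟩
      gcongr
      norm_num

theorem norm_weightRatio_le (m : ℕ) :
    ‖weightRatio (m + 4)‖ ≤ 1 / 20 ∧ (36 ≤ m → ‖weightRatio (m + 4)‖ ≤ 1 / 45) := by
  have e : weightRatio (m + 4) = ((-(128 * (m + 4) ^ 3 * (m + 4 + 1) ^ 3 * (2 * (m + 4) + 1) /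
      ((2 * m + 7) * (2 * m + 9) * (5 * m + 20) * (5 * m + 19) * (5 * m + 21) * (5 * m + 22) *
        (5 * m + 23))) : ℝ) : ℂ) := by
    rw [weightRatio, certDen]
    push_cast
    rw [← neg_div]
    congr 1 <;> ring
  rw [e, Complex.norm_real, norm_neg, Real.norm_of_nonneg (by positivity)]
  constructor
  · rw [div_le_iff₀ (by positivity), ← sub_nonneg]
    ring_nf
    positivity
  · intro hm
    obtain ⟨k, rfl⟩ := Nat.exists_eq_add_of_le hm
    rw [div_le_iff₀ (by positivity), ← sub_nonneg]
    push_cast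
    ring_nf
    positivity

theorem geometric_bound {a : ℕ → ℝ} (ha : ∀ m, 0 ≤ a m) {N : ℕ} (h₁ : ∀ m, a (m + 1) ≤ 16 / 5 * a m)
    (h₂ : ∀ m, N ≤ m → a (m + 1) ≤ 4 / 5 * a m) (m : ℕ) :
    a m ≤ 4 ^ N * (4 / 5) ^ m * a 0 := by
  suffices a m ≤ 4 ^ (min m N) * (4 / 5) ^ m * a 0 by
    refine this.trans ?_
    have := ha 0
    gcongr
    · norm_num
    · exact min_le_right _ _
  induction m with
  | zero => simp
  | succ m ih =>
    rcases le_or_gt N m with h | h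
    · rw [min_eq_right h] at ih
      rw [min_eq_right (by omega)]
      refine (h₂ m h).trans ?_
      calc _ ≤ 4 / 5 * (4 ^ N * (4 / 5) ^ m * a 0) := by gcongr
        _ = _ := by ring
    · rw [min_eq_left h.le] at ih
      rw [min_eq_left (by omega)]
      refine (h₁ m).trans ?_
      calc _ ≤ 16 / 5 * (4 ^ m * (4 / 5) ^ m * a 0) := by gcongr
        _ = _ := by ring

theorem norm_beta_le {u : ℂ} (h : Good u) (m : ℕ) :
    ‖beta m u‖ * (1 + ‖u‖) ^ 6 ≤ 4 ^ 36 * 200 ^ 12 * (4 / 5) ^ m := by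
  have key := geometric_bound (a := fun m => ‖beta m u‖ * (1 + ‖u‖) ^ 6) (N := 36)
    (fun m => by positivity) (fun m => ?_) (fun m hm => ?_) m
  · calc _ ≤ _ := key
      _ ≤ 4 ^ 36 * (4 / 5) ^ m * 200 ^ 12 := by
        gcongr
        exact beta_zero_bound h
      _ = _ := by ring
  · have := (norm_beta_succ_le h m).1
    have hw := (norm_weightRatio_le m).1
    calc _ ≤ (64 * ‖weightRatio (m + 4)‖ * ‖beta m u‖) * (1 + ‖u‖) ^ 6 := by gcongr
      _ ≤ (64 * (1 / 20) * ‖beta m u‖) * (1 + ‖u‖) ^ 6 := by gcongr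
      _ = _ := by ring
  · have := (norm_beta_succ_le h m).2 hm
    have hw := (norm_weightRatio_le m).2 hm
    calc _ ≤ (36 * ‖weightRatio (m + 4)‖ * ‖beta m u‖) * (1 + ‖u‖) ^ 6 := by gcongr
      _ ≤ (36 * (1 / 45) * ‖beta m u‖) * (1 + ‖u‖) ^ 6 := by gcongr
      _ = _ := by ring

theorem norm_certNum_le {n : ℝ} (hn : 1 ≤ n) (u : ℂ) :
    ‖certNum n u‖ ≤ 12000000 * n ^ 14 * (1 + ‖u‖) ^ 5 := by
  obtain ⟨k, rfl⟩ : ∃ k, n = 1 + k := ⟨n - 1, by ring⟩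
  have hk : 0 ≤ k := by linarith
  have h0 : |(84 * (1 + k) ^ 4 + 70 * (1 + k) ^ 5 - 2973 * (1 + k) ^ 6 - 5459 / 2 * (1 + k) ^ 7 + 32538 * (1 + k) ^ 8 + 30012 * (1 + k) ^ 9 - 129540 * (1 + k) ^ 10 + 5119 / 2 * (1 + k) ^ 11 + 158763 * (1 + k) ^ 12 - 110912 * (1 + k) ^ 13 + 22128 * (1 + k) ^ 14 : ℝ)| ≤ 2000000 * (1 + k) ^ 14 := by
    rw [abs_le]
    constructor <;> rw [← sub_nonneg] <;> ring_nf <;> positivity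
  have h1 : |(72 * (1 + k) ^ 2 - 212 * (1 + k) ^ 3 - 3654 * (1 + k) ^ 4 + 7091 * (1 + k) ^ 5 + 26500 * (1 + k) ^ 6 - 76428 * (1 + k) ^ 7 + 18856 * (1 + k) ^ 8 - 237325 * (1 + k) ^ 9 - 214490 * (1 + k) ^ 10 + 512578 * (1 + k) ^ 11 - 205500 * (1 + k) ^ 12 : ℝ)| ≤ 2000000 * (1 + k) ^ 14 := by
    rw [abs_le]
    constructor <;> rw [← sub_nonneg] <;> ring_nf <;> positivity
  have h2 : |(-12 - 2 * (1 + k) - 213 * (1 + k) ^ 2 + 1201 / 2 * (1 + k) ^ 3 + 1882 * (1 + k) ^ 4 + 50892 * (1 + k) ^ 5 - 145840 * (1 + k) ^ 6 + 544163 / 2 * (1 + k) ^ 7 + 369047 * (1 + k) ^ 8 - 294668 * (1 + k) ^ 9 + 595320 * (1 + k) ^ 10 : ℝ)| ≤ 2000000 * (1 + k) ^ 14 := by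
    rw [abs_le]
    constructor <;> rw [← sub_nonneg] <;> ring_nf <;> positivity
  have h3 : |(108 + 510 * (1 + k) + 352 * (1 + k) ^ 2 - 9852 * (1 + k) ^ 3 + 68960 * (1 + k) ^ 4 - 162500 * (1 + k) ^ 5 - 95064 * (1 + k) ^ 6 + 71258 * (1 + k) ^ 7 - 565260 * (1 + k) ^ 8 : ℝ)| ≤ 2000000 * (1 + k) ^ 14 := by
    rw [abs_le]
    constructor <;> rw [← sub_nonneg] <;> ring_nf <;> positivity
  have h4 : |(-288 - 2544 * (1 + k) - 6992 * (1 + k) ^ 2 + 29728 * (1 + k) ^ 3 - 42544 * (1 + k) ^ 4 + 21392 * (1 + k) ^ 5 + 230880 * (1 + k) ^ 6 : ℝ)| ≤ 2000000 * (1 + k) ^ 14 := by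
    rw [abs_le]
    constructor <;> rw [← sub_nonneg] <;> ring_nf <;> positivity
  have h5 : |(192 + 2144 * (1 + k) + 8320 * (1 + k) ^ 2 - 13024 * (1 + k) ^ 3 - 30912 * (1 + k) ^ 4 : ℝ)| ≤ 2000000 * (1 + k) ^ 14 := by
    rw [abs_le]
    constructor <;> rw [← sub_nonneg] <;> ring_nf <;> positivity
  have hu := norm_nonneg u
  have term : ∀ (c : ℝ) (d : ℕ), d ≤ 5 → |c| ≤ 2000000 * (1 + k) ^ 14 →
      ‖(c : ℂ) * u ^ d‖ ≤ 2000000 * (1 + k) ^ 14 * (1 + ‖u‖) ^ 5 := fun c d hd hc => by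
    rw [norm_mul, Complex.norm_real, Real.norm_eq_abs, norm_pow]
    have : ‖u‖ ^ d ≤ (1 + ‖u‖) ^ 5 :=
      (pow_le_pow_left₀ hu (by linarith) d).trans (pow_le_pow_right₀ (by linarith) hd)
    gcongr
  have t0 := term _ 0 (by norm_num) h0
  have t1 := term _ 1 (by norm_num) h1
  have t2 := term _ 2 (by norm_num) h2
  have t3 := term _ 3 (by norm_num) h3
  have t4 := term _ 4 (by norm_num) h4
  have t5 := term _ 5 (by norm_num) h5
  have key := norm_add_le_of_le (norm_add_le_of_le (norm_add_le_of_le (norm_add_le_of_le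
    (norm_add_le_of_le t0 t1) t2) t3) t4) t5
  refine le_trans (le_of_eq ?_) (key.trans (le_of_eq (by ring)))
  congr 1
  unfold certNum
  push_cast
  ring

theorem one_le_norm_certDen (m : ℕ) : 1 ≤ ‖certDen (m + 4)‖ := by
  have e : certDen (m + 4) = (((2 * m + 7) * (2 * m + 9) * (5 * m + 20) * (5 * m + 19) *
      (5 * m + 21) * (5 * m + 22) * (5 * m + 23) : ℕ) : ℂ) := by
    rw [certDen]
    push_cast
    ring
  rw [e, Complex.norm_natCast]
  exact_mod_cast Nat.succ_le_of_lt (by positivity)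

/-- Geometric majorant for the companion terms. -/
noncomputable def majorant (m : ℕ) : ℝ :=
  4 ^ 36 * 200 ^ 12 * 12000000 * ((m + 4 : ℝ) ^ 14 * (4 / 5) ^ m)

theorem majorant_nonneg (m : ℕ) : 0 ≤ majorant m := by unfold majorant; positivity

theorem summable_majorant : Summable majorant := by
  refine Summable.mul_left _ ?_
  have h : Summable fun m : ℕ => ((m + 4 : ℕ) : ℝ) ^ 14 * (4 / 5 : ℝ) ^ (m + 4) :=
    (summable_nat_add_iff (f := fun m : ℕ => (m : ℝ) ^ 14 * (4 / 5) ^ m) 4).2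
      (summable_pow_mul_geometric_of_norm_lt_one 14 (by norm_num))
  refine (h.mul_left ((5 / 4 : ℝ) ^ 4)).congr fun m => ?_
  push_cast
  rw [pow_add]
  ring

theorem norm_beta_mul_certNum_le {u : ℂ} (h : Good u) (m : ℕ) :
    ‖beta m u * certNum (m + 4) u / certDen (m + 4)‖ * (1 + ‖u‖) ≤ majorant m := by
  have h₁ := norm_beta_le h m
  have h₂ := norm_certNum_le (n := (m : ℝ) + 4) (by have : (0 : ℝ) ≤ m := m.cast_nonneg
                                                    linarith) u
  push_cast at h₂
  have h₃ := one_le_norm_certDen m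
  have hu := norm_nonneg u
  rw [norm_div, norm_mul, div_mul_eq_mul_div, div_le_iff₀ (by linarith)]
  have hc : ‖beta m u‖ * ‖certNum (m + 4) u‖ * (1 + ‖u‖) ≤ majorant m := by
    calc _ ≤ ‖beta m u‖ * (12000000 * ((m : ℝ) + 4) ^ 14 * (1 + ‖u‖) ^ 5) * (1 + ‖u‖) := by gcongr
      _ = (‖beta m u‖ * (1 + ‖u‖) ^ 6) * (12000000 * ((m : ℝ) + 4) ^ 14) := by ring
      _ ≤ (4 ^ 36 * 200 ^ 12 * (4 / 5) ^ m) * (12000000 * ((m : ℝ) + 4) ^ 14) := by gcongr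
      _ = _ := by rw [majorant]; ring
  exact hc.trans (le_mul_of_one_le_right (majorant_nonneg m) h₃)

theorem norm_companion_le {u : ℂ} (h : Good u) (m : ℕ) :
    ‖companion m u‖ ≤ majorant m * (1 + ‖u‖) := by
  have h₁ := norm_beta_mul_certNum_le h m
  have hu : ‖u - 1 / 4‖ ≤ 1 + ‖u‖ := by
    have := norm_sub_le u (1 / 4)
    norm_num at this ⊢
    linarith
  rw [companion, mul_assoc, mul_div_assoc, norm_mul, norm_pow]
  calc _ ≤ (1 + ‖u‖) ^ 2 * ‖beta m u * certNum (m + 4) u / certDen (m + 4)‖ := by gcongr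
    _ = ‖beta m u * certNum (m + 4) u / certDen (m + 4)‖ * (1 + ‖u‖) * (1 + ‖u‖) := by ring
    _ ≤ _ := by gcongr

theorem summable_companion {u : ℂ} (h : Good u) : Summable fun m => companion m u :=
  Summable.of_norm_bounded (summable_majorant.mul_right _) (norm_companion_le h)

/-- The complete companion sum, multiplied by `u`. -/
noncomputable def total (u : ℂ) : ℂ := head u + ∑' m, companion m u

theorem tendsto_pow_mul_beta {u : ℂ} (h : Good u) (p : ℕ) :
    Filter.Tendsto (fun m : ℕ => (m : ℂ) ^ p * beta m u) Filter.atTop (nhds 0) := by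
  refine squeeze_zero_norm (a := fun m : ℕ => 4 ^ 36 * 200 ^ 12 * ((m : ℝ) ^ p * (4 / 5) ^ m))
    (fun m => ?_) ?_
  · have h₁ := norm_beta_le h m
    have h₂ : ‖beta m u‖ ≤ ‖beta m u‖ * (1 + ‖u‖) ^ 6 :=
      le_mul_of_one_le_right (norm_nonneg _) (one_le_pow₀ (by linarith [norm_nonneg u]))
    rw [norm_mul, norm_pow, Complex.norm_natCast]
    calc _ ≤ (m : ℝ) ^ p * (4 ^ 36 * 200 ^ 12 * (4 / 5) ^ m) := by
          gcongr
          exact h₂.trans h₁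
      _ = _ := by ring
  · have := (summable_pow_mul_geometric_of_norm_lt_one (R := ℝ) (r := 4 / 5) p
      (by norm_num)).tendsto_atTop_zero
    simpa using this.const_mul (4 ^ 36 * 200 ^ 12)

theorem tendsto_pow_mul_affine_mul {f : ℕ → ℂ} (a b : ℂ)
    (hf : ∀ p : ℕ, Filter.Tendsto (fun m : ℕ => (m : ℂ) ^ p * f m) Filter.atTop (nhds 0)) (p : ℕ) :
    Filter.Tendsto (fun m : ℕ => (m : ℂ) ^ p * ((a + b * m) * f m)) Filter.atTop (nhds 0) := by
  have := ((hf p).const_mul a).add ((hf (p + 1)).const_mul b)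
  simp only [mul_zero, add_zero] at this
  refine this.congr fun m => ?_
  ring

theorem tendsto_summand {s : ℂ} (h : NotHalf s) (hg : Good ((s - 1 / 2) ^ 2)) :
    Filter.Tendsto (fun m => summand m s) Filter.atTop (nhds 0) := by
  have h0 := (h.ne 0).1
  push_cast at h0
  rw [zero_add] at h0
  have e : ∀ m : ℕ, summand m s = (2 * s * ((s + 2 * (m + 4) - 1) * (2 * s + (m + 4) - 2) *
      (2 * s + (m + 4) - 3)) * (s - (m + 4) - 1 / 2) ^ 3) *
      (((s - 1 / 2) ^ 2 - 1 / 4) ^ 2 / (s - 1 / 2) ^ 2) * beta m ((s - 1 / 2) ^ 2) := fun m => by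
    have := beta_core h m
    rw [summand, mul_div_assoc', div_mul_eq_mul_div, eq_div_iff (pow_ne_zero _ h0)]
    linear_combination (-2 * s * ((s + 2 * (m + 4) - 1) * (2 * s + (m + 4) - 2) *
      (2 * s + (m + 4) - 3))) * this
  have a₁ := tendsto_pow_mul_affine_mul (s + 7) 2 (tendsto_pow_mul_beta hg)
  have a₂ := tendsto_pow_mul_affine_mul (2 * s + 2) 1 a₁
  have a₃ := tendsto_pow_mul_affine_mul (2 * s + 1) 1 a₂
  have a₄ := tendsto_pow_mul_affine_mul (s - 9 / 2) (-1) a₃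
  have a₅ := tendsto_pow_mul_affine_mul (s - 9 / 2) (-1) a₄
  have a₆ := tendsto_pow_mul_affine_mul (s - 9 / 2) (-1) a₅ 0
  have key := a₆.const_mul (2 * s * (((s - 1 / 2) ^ 2 - 1 / 4) ^ 2 / (s - 1 / 2) ^ 2))
  rw [mul_zero] at key
  refine key.congr fun m => ?_
  rw [e]
  ring

theorem total_sub {s : ℂ} (h : NotHalf s) (h₁ : Good ((s - 1 / 2) ^ 2)) (h₂ : Good ((s + 1 / 2) ^ 2)) :
    total ((s + 1 / 2) ^ 2) / (s + 1 / 2) ^ 2 - total ((s - 1 / 2) ^ 2) / (s - 1 / 2) ^ 2 =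
      -base s := by
  have hs : HasSum (fun m => summand (m + 1) s - summand m s)
      (∑' m, companion m ((s + 1 / 2) ^ 2) / (s + 1 / 2) ^ 2 -
        ∑' m, companion m ((s - 1 / 2) ^ 2) / (s - 1 / 2) ^ 2) := by
    simp only [summand_succ_sub h]
    exact ((summable_companion h₂).div_const _).hasSum.sub ((summable_companion h₁).div_const _).hasSum
  have ht := hs.tendsto_sum_nat
  simp only [Finset.sum_range_sub (fun m => summand m s)] at ht
  have := tendsto_nhds_unique ht ((tendsto_summand h h₁).sub_const _)
  rw [tsum_div_const, tsum_div_const] at this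
  rw [total, total, add_div, add_div]
  linear_combination this - summand_zero_sub_base h

open Filter Topology

/-- The shifted cubic series `∑ 1 / (k + 1 + z) ^ 3`. -/
noncomputable def cubicTail (z : ℂ) : ℂ := ∑' k : ℕ, 1 / ((k : ℂ) + 1 + z) ^ 3

theorem norm_natCast_add_ge {z : ℂ} (hz : -(3 / 4) ≤ z.re) (k : ℕ) :
    ((k : ℝ) + 1) / 4 ≤ ‖(k : ℂ) + 1 + z‖ := by
  refine le_trans ?_ (Complex.re_le_norm _)
  simp only [Complex.add_re, Complex.natCast_re, Complex.one_re]
  have : (0 : ℝ) ≤ k := k.cast_nonneg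
  linarith

theorem norm_cubicTail_term_le {z : ℂ} (hz : -(3 / 4) ≤ z.re) (k : ℕ) :
    ‖1 / ((k : ℂ) + 1 + z) ^ 3‖ ≤ 64 * (1 / ((k : ℝ) + 1) ^ 3) := by
  have h := norm_natCast_add_ge hz k
  rw [norm_div, norm_one, norm_pow]
  calc _ ≤ 1 / (((k : ℝ) + 1) / 4) ^ 3 := by gcongr
    _ = _ := by field_simp; norm_num

theorem summable_one_div_succ_pow {p : ℕ} (hp : 1 < p) :
    Summable fun k : ℕ => 1 / ((k : ℝ) + 1) ^ p := by
  have := (summable_nat_add_iff 1).2 (Real.summable_one_div_nat_pow.2 hp)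
  simpa using this

theorem summable_cubicTail {z : ℂ} (hz : -(3 / 4) ≤ z.re) :
    Summable fun k : ℕ => 1 / ((k : ℂ) + 1 + z) ^ 3 :=
  Summable.of_norm_bounded ((summable_one_div_succ_pow (by norm_num)).mul_left 64)
    (norm_cubicTail_term_le hz)

theorem cubicTail_eq {z : ℂ} (hz : -(3 / 4) ≤ z.re) :
    cubicTail z = 1 / (1 + z) ^ 3 + cubicTail (z + 1) := by
  rw [cubicTail, (summable_cubicTail hz).tsum_eq_zero_add, cubicTail]
  congr 1
  · simp
  · refine tsum_congr fun k => ?_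
    push_cast
    ring_nf

/-- The difference of the two sides of the contiguous identity. -/
noncomputable def defect (t : ℂ) : ℂ :=
  total (t ^ 2) / t ^ 2 - 7 / (8 * t ^ 2) + 3 / 8 * (cubicTail t + cubicTail (-t)) +
    (1 / 2 - 3 / 4 * cubicTail (1 / 2))

theorem good_sq {t : ℂ} (h : |t.re| ≤ 3 / 4) : Good (t ^ 2) := by
  left
  rw [sq, Complex.mul_re]
  rw [abs_le] at h
  nlinarith [sq_nonneg t.im]

theorem base_eq {s : ℂ} (h : NotHalf s) : base s =
    -3 / 8 * (1 / (s - 1 / 2) ^ 3 + 1 / (s + 1 / 2) ^ 3) +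
      7 / 8 * (1 / (s - 1 / 2) ^ 2 - 1 / (s + 1 / 2) ^ 2) := by
  obtain ⟨a, b⟩ := h.ne 0
  norm_num at a b
  rw [base, show s ^ 2 - 1 / 4 = (s - 1 / 2) * (s + 1 / 2) by ring]
  have hs : s = (s - 1 / 2) + 1 / 2 := by ring
  have hb : s + 1 / 2 = (s - 1 / 2) + 1 := by ring
  generalize s - 1 / 2 = A at *
  rw [hb] at b ⊢
  rw [hs]
  field_simp
  ring

theorem notHalf_of_re {s : ℂ} (h : |s.re| < 1 / 2) : NotHalf s := by
  intro j hj
  rw [abs_lt] at h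
  have hj0 : (0 : ℝ) ≤ j := j.cast_nonneg
  rcases sq_eq_sq_iff_eq_or_eq_neg.1 hj with rfl | rfl
  all_goals
    norm_num at h
    linarith

theorem defect_add_one {t : ℂ} (h₁ : -(3 / 4) < t.re) (h₂ : t.re < -(1 / 4)) :
    defect (t + 1) = defect t := by
  obtain ⟨s, rfl⟩ : ∃ s, t = s - 1 / 2 := ⟨t + 1 / 2, by ring⟩
  have hre : (s - 1 / 2).re = s.re - 1 / 2 := by simp
  rw [hre] at h₁ h₂
  have hs : NotHalf s := notHalf_of_re (by rw [abs_lt]; constructor <;> linarith)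
  have e : s - 1 / 2 + 1 = s + 1 / 2 := by ring
  have hre' : (s + 1 / 2).re = s.re + 1 / 2 := by simp
  have key := total_sub hs (good_sq (by rw [hre, abs_le]; constructor <;> linarith))
    (good_sq (by rw [hre', abs_le]; constructor <;> linarith))
  have c₁ := cubicTail_eq (z := s - 1 / 2) (by rw [hre]; linarith)
  have c₂ := cubicTail_eq (z := -(s + 1 / 2)) (by rw [Complex.neg_re, hre']; linarith)
  rw [e] at c₁
  rw [show -(s + 1 / 2) + 1 = -(s - 1 / 2) by ring,
    show 1 / (1 + -(s + 1 / 2)) ^ 3 = -(1 / (s - 1 / 2) ^ 3) by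
      rw [show 1 + -(s + 1 / 2) = -(s - 1 / 2) by ring, Odd.neg_pow (by decide), div_neg]] at c₂
  rw [show 1 + (s - 1 / 2) = s + 1 / 2 by ring] at c₁
  rw [base_eq hs] at key
  rw [defect, defect, e]
  have e7 : ∀ z : ℂ, 7 / (8 * z ^ 2) = 7 / 8 * (1 / z ^ 2) := fun z => by
    rw [div_mul_div_comm, mul_one]
  rw [e7, e7]
  linear_combination key - 3 / 8 * c₁ + 3 / 8 * c₂

theorem tendsto_sub_div_sub (a b : ℂ) :
    Tendsto (fun u : ℂ => (u - a) / (u - b)) (Bornology.cobounded ℂ) (𝓝 1) := by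
  have hi : Tendsto (fun u : ℂ => u⁻¹) (Bornology.cobounded ℂ) (𝓝 0) := tendsto_inv₀_cobounded
  have : Tendsto (fun u : ℂ => (1 - a * u⁻¹) / (1 - b * u⁻¹)) (Bornology.cobounded ℂ) (𝓝 ((1 - a * 0) / (1 - b * 0))) :=
    (tendsto_const_nhds.sub (hi.const_mul a)).div (tendsto_const_nhds.sub (hi.const_mul b)) (by simp)
  simp only [mul_zero, sub_zero, div_one] at this
  refine this.congr' ?_
  filter_upwards [Bornology.eventually_ne_cobounded (0 : ℂ)] with u hu
  rw [← mul_div_mul_right (u - a) (u - b) (inv_ne_zero hu), sub_mul, sub_mul, mul_inv_cancel₀ hu]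

theorem exists_tendsto_beta (m : ℕ) :
    ∃ b, Tendsto (fun u : ℂ => u ^ 6 * beta m u) (Bornology.cobounded ℂ) (𝓝 b) := by
  have r := tendsto_sub_div_sub
  induction m with
  | zero =>
    have hn := (((((r (9/4) 1).mul (r (25/4) 1)).mul (r (49/4) 1)).mul (r (81/4) 4)).mul
      (r (121/4) 4)).mul (r (169/4) 4)
    have hd := (((r 0 9).mul (r 0 16)).pow 3)
    refine ⟨_, ((hn.mul hd).const_mul (-2097152 / 670044375)).congr fun u => ?_⟩
    rw [beta, sub_zero]
    simp only [div_eq_mul_inv, mul_inv, mul_pow, ← inv_pow]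
    generalize (u - 1)⁻¹ = A
    generalize (u - 4)⁻¹ = B
    generalize (u - 9)⁻¹ = C
    generalize (u - 16)⁻¹ = D
    ring
  | succ m ih =>
    obtain ⟨b, hb⟩ := ih
    have h := ((r ((2 * (m + 4) - 1 / 2) ^ 2) ((m + 4 + 1) ^ 2)).mul
      (r ((2 * (m + 4) + 1 / 2) ^ 2) ((m + 4 + 1) ^ 2))).mul
      ((r (((m + 4 : ℂ) - 2) ^ 2 / 4) ((m + 4 + 1) ^ 2)).const_mul 4)
    refine ⟨_, ((hb.mul h).mul_const (weightRatio (m + 4))).congr fun u => ?_⟩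
    rw [beta]
    simp only [div_eq_mul_inv, ← inv_pow]
    generalize (u - (m + 4 + 1) ^ 2)⁻¹ = A
    ring

theorem exists_tendsto_certNum (n : ℂ) :
    ∃ b, Tendsto (fun u : ℂ => certNum n u / u ^ 5) (Bornology.cobounded ℂ) (𝓝 b) := by
  have hi : Tendsto (fun u : ℂ => u⁻¹) (Bornology.cobounded ℂ) (𝓝 0) := tendsto_inv₀_cobounded
  have aux : ∀ c₀ c₁ c₂ c₃ c₄ c₅ : ℂ, ∃ b, Tendsto (fun u : ℂ => (c₀ + c₁ * u + c₂ * u ^ 2 +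
      c₃ * u ^ 3 + c₄ * u ^ 4 + c₅ * u ^ 5) / u ^ 5) (Bornology.cobounded ℂ) (𝓝 b) := by
    intro c₀ c₁ c₂ c₃ c₄ c₅
    have hc : Continuous fun v : ℂ => c₀ * v ^ 5 + c₁ * v ^ 4 + c₂ * v ^ 3 + c₃ * v ^ 2 + c₄ * v + c₅ := by
      fun_prop
    refine ⟨_, ((hc.tendsto 0).comp hi).congr' ?_⟩
    filter_upwards [Bornology.eventually_ne_cobounded (0 : ℂ)] with u hu
    simp only [Function.comp]
    field_simp
  exact aux _ _ _ _ _ _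

theorem exists_tendsto_head :
    ∃ b, Tendsto (fun u : ℂ => head u / u) (Bornology.cobounded ℂ) (𝓝 b) := by
  have hi : Tendsto (fun u : ℂ => u⁻¹) (Bornology.cobounded ℂ) (𝓝 0) := tendsto_inv₀_cobounded
  have r := tendsto_sub_div_sub 0
  have hc : Continuous fun v : ℂ => (-1334762990316000 * v ^ 10 + 7217743180681440 * v ^ 9
      - 9254728385746578 * v ^ 8 + 8020936148106255 * v ^ 7 - 4631506328917943 * v ^ 6
      + 1638601202562870 * v ^ 5 - 373141164191928 * v ^ 4 + 55609176849235 * v ^ 3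
      - 5189086867503 * v ^ 2 + 272191480200 * v - 6088280048) / 32162130000 := by
    fun_prop
  refine ⟨_, (((hc.tendsto 0).comp hi).mul ((((r 1).mul (r 4)).mul (r 9)).pow 3)).congr' ?_⟩
  filter_upwards [Bornology.eventually_ne_cobounded (0 : ℂ)] with u hu
  simp only [Function.comp, head, headNum, sub_zero, div_eq_mul_inv, mul_inv, mul_pow, ← inv_pow]
  generalize (u - 1)⁻¹ = A
  generalize (u - 4)⁻¹ = B
  generalize (u - 9)⁻¹ = C
  field_simp

theorem exists_tendsto_companion (m : ℕ) :
    ∃ b, Tendsto (fun u : ℂ => companion m u / u) (Bornology.cobounded ℂ) (𝓝 b) := by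
  obtain ⟨b, hb⟩ := exists_tendsto_beta m
  obtain ⟨c, hc⟩ := exists_tendsto_certNum (m + 4)
  refine ⟨_, ((((tendsto_sub_div_sub (1 / 4) 0).pow 2).mul hb).mul hc).div_const
    (certDen (m + 4)) |>.congr' ?_⟩
  filter_upwards [Bornology.eventually_ne_cobounded (0 : ℂ)] with u hu
  rw [companion, sub_zero]
  have := certDen_ne_zero m
  field_simp

theorem exists_tendsto_total :
    ∃ b, Tendsto (fun u : ℂ => total u / u) (Bornology.cobounded ℂ ⊓ 𝓟 {u | Good u}) (𝓝 b) := by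
  obtain ⟨b, hb⟩ := exists_tendsto_head
  choose c hc using exists_tendsto_companion
  have key : Tendsto (fun u : ℂ => ∑' m, companion m u / u) (Bornology.cobounded ℂ ⊓ 𝓟 {u | Good u})
      (𝓝 (∑' m, c m)) := by
    refine tendsto_tsum_of_dominated_convergence (summable_majorant.mul_right 2)
      (fun m => (hc m).mono_left inf_le_left) ?_
    rw [eventually_inf_principal]
    have h1 : ∀ᶠ u : ℂ in Bornology.cobounded ℂ, 1 ≤ ‖u‖ :=
      tendsto_norm_cobounded_atTop.eventually (eventually_ge_atTop 1)
    filter_upwards [h1] with u hu hg m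
    rw [norm_div, div_le_iff₀ (by linarith)]
    refine (norm_companion_le hg m).trans ?_
    rw [mul_assoc]
    gcongr
    · exact majorant_nonneg m
    · linarith
  refine ⟨_, ((hb.mono_left inf_le_left).add key).congr fun u => ?_⟩
  rw [tsum_div_const, total, add_div]

theorem notHalf_natCast (K : ℕ) : NotHalf K := by
  intro j hj
  rcases sq_eq_sq_iff_eq_or_eq_neg.1 hj with h | h
  · have : ((2 * K : ℕ) : ℂ) = ((2 * j + 1 : ℕ) : ℂ) := by push_cast; rw [h]; ring
    have := Nat.cast_injective this
    omega
  · have : ((2 * K + (2 * j + 1) : ℕ) : ℂ) = ((0 : ℕ) : ℂ) := by push_cast; rw [h]; ring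
    have := Nat.cast_injective this
    omega

theorem good_natCast (K : ℕ) : Good (((K : ℂ) + 1 / 2) ^ 2) := by
  rcases Nat.eq_zero_or_pos K with rfl | h
  · left; norm_num [sq]
  · right
    exact ⟨K + 1, by omega, by push_cast; ring⟩

theorem total_quarter : total (1 / 4) = 0 := by
  have : ∀ m, companion m (1 / 4) = 0 := fun m => by simp [companion]
  simp only [total, this, tsum_zero, add_zero, head, headNum]
  norm_num

theorem total_natCast (K : ℕ) : total (((K : ℂ) + 1 / 2) ^ 2) / ((K : ℂ) + 1 / 2) ^ 2 =
    3 / 8 * (∑ k ∈ Finset.range K, 1 / ((k : ℂ) + 1 + -(1 / 2)) ^ 3 +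
      ∑ k ∈ Finset.range K, 1 / ((k : ℂ) + 1 + 1 / 2) ^ 3) -
      7 / 8 * (4 - 1 / ((K : ℂ) + 1 / 2) ^ 2) := by
  induction K with
  | zero =>
    norm_num
    rw [total_quarter]
  | succ K ih =>
    have hs := notHalf_natCast (K + 1)
    have h₁ := good_natCast K
    have h₂ := good_natCast (K + 1)
    have e : ((K + 1 : ℕ) : ℂ) - 1 / 2 = K + 1 / 2 := by push_cast; ring
    rw [← e] at h₁ ih
    have key := total_sub hs h₁ h₂
    rw [base_eq hs] at key
    rw [Finset.sum_range_succ, Finset.sum_range_succ]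
    have e' : ((K + 1 : ℕ) : ℂ) - 1 / 2 = K + 1 + -(1 / 2) := by push_cast; ring
    have e'' : ((K + 1 : ℕ) : ℂ) + 1 / 2 = K + 1 + 1 / 2 := by push_cast; ring
    rw [← e', ← e'']
    linear_combination key + ih

theorem tendsto_natCast_add_half_sq :
    Tendsto (fun K : ℕ => ((K : ℂ) + 1 / 2) ^ 2) atTop (Bornology.cobounded ℂ ⊓ 𝓟 {u | Good u}) := by
  refine tendsto_inf.2 ⟨?_, tendsto_principal.2 (Eventually.of_forall good_natCast)⟩
  rw [← tendsto_norm_atTop_iff_cobounded]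
  refine tendsto_atTop_mono (fun K => ?_) tendsto_natCast_atTop_atTop
  have e : ((K : ℂ) + 1 / 2) ^ 2 = (((K + 1 / 2) ^ 2 : ℝ) : ℂ) := by push_cast; ring
  rw [e, Complex.norm_real]
  refine le_trans ?_ (le_abs_self _)
  nlinarith

theorem tendsto_total_natCast :
    Tendsto (fun K : ℕ => total (((K : ℂ) + 1 / 2) ^ 2) / ((K : ℂ) + 1 / 2) ^ 2) atTop
      (𝓝 (-(1 / 2 - 3 / 4 * cubicTail (1 / 2)))) := by
  simp only [total_natCast]
  have h₁ := (summable_cubicTail (z := -(1 / 2)) (by norm_num)).hasSum.tendsto_sum_nat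
  have h₂ := (summable_cubicTail (z := 1 / 2) (by norm_num)).hasSum.tendsto_sum_nat
  have h₃ : Tendsto (fun K : ℕ => (((K : ℂ) + 1 / 2) ^ 2)⁻¹) atTop (𝓝 0) :=
    tendsto_inv₀_cobounded.comp (tendsto_inf.1 tendsto_natCast_add_half_sq).1
  have key := ((h₁.add h₂).const_mul (3 / 8)).sub ((h₃.const_sub 4).const_mul (7 / 8))
  change Tendsto _ _ (𝓝 (3 / 8 * (cubicTail (-(1 / 2)) + cubicTail (1 / 2)) - 7 / 8 * (4 - 0))) at key
  rw [cubicTail_eq (by norm_num)] at key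
  simp only [← one_div] at key
  convert key using 2
  rw [show -(1 / 2 : ℂ) + 1 = 1 / 2 by norm_num]
  ring

theorem tendsto_total :
    Tendsto (fun u : ℂ => total u / u) (Bornology.cobounded ℂ ⊓ 𝓟 {u | Good u})
      (𝓝 (-(1 / 2 - 3 / 4 * cubicTail (1 / 2)))) := by
  obtain ⟨b, hb⟩ := exists_tendsto_total
  rwa [tendsto_nhds_unique tendsto_total_natCast (hb.comp tendsto_natCast_add_half_sq)]

/-- The vertical strip on which the defect is studied. -/
def strip : Set ℂ := {t | |t.re| < 3 / 4}

theorem tendsto_norm_sq : Tendsto (fun t : ℂ => t ^ 2) (Bornology.cobounded ℂ ⊓ 𝓟 strip)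
    (Bornology.cobounded ℂ ⊓ 𝓟 {u | Good u}) := by
  refine tendsto_inf.2 ⟨?_, tendsto_principal.2 ?_⟩
  · refine Tendsto.mono_left ?_ inf_le_left
    rw [← tendsto_norm_atTop_iff_cobounded]
    simp only [norm_pow]
    exact (tendsto_pow_atTop (by norm_num)).comp tendsto_norm_cobounded_atTop
  · exact eventually_inf_principal.2 (Eventually.of_forall fun t ht => good_sq (le_of_lt ht))

theorem tendsto_cubicTail {l : Filter ℂ} {f : ℂ → ℂ} (hf : Tendsto f l (Bornology.cobounded ℂ))
    (hre : ∀ᶠ t in l, -(3 / 4) ≤ (f t).re) : Tendsto (fun t => cubicTail (f t)) l (𝓝 0) := by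
  have : Tendsto (fun t => ∑' k : ℕ, 1 / ((k : ℂ) + 1 + f t) ^ 3) l (𝓝 (∑' _ : ℕ, (0 : ℂ))) := by
    refine tendsto_tsum_of_dominated_convergence
      ((summable_one_div_succ_pow (p := 3) (by norm_num)).mul_left 64) (fun k => ?_) ?_
    · have h₁ : Tendsto (fun t => (k : ℂ) + 1 + f t) l (Bornology.cobounded ℂ) :=
        (tendsto_const_add_cobounded ((k : ℂ) + 1)).comp hf
      have h₂ := (tendsto_inv₀_cobounded.comp h₁).pow 3
      simpa [Function.comp_def] using h₂
    · filter_upwards [hre] with t ht k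
      exact norm_cubicTail_term_le ht k
  simpa [cubicTail] using this

theorem tendsto_defect : Tendsto defect (Bornology.cobounded ℂ ⊓ 𝓟 strip) (𝓝 0) := by
  have hid : Tendsto (fun t : ℂ => t) (Bornology.cobounded ℂ ⊓ 𝓟 strip) (Bornology.cobounded ℂ) :=
    tendsto_id.mono_left inf_le_left
  have hneg : Tendsto (fun t : ℂ => -t) (Bornology.cobounded ℂ ⊓ 𝓟 strip) (Bornology.cobounded ℂ) := by
    rw [← tendsto_norm_atTop_iff_cobounded] at hid ⊢
    simpa using hid
  have hs : ∀ᶠ t in Bornology.cobounded ℂ ⊓ 𝓟 strip, t ∈ strip :=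
    eventually_inf_principal.2 (Eventually.of_forall fun t ht => ht)
  have h₁ := tendsto_cubicTail hid (hs.mono fun t ht => (abs_lt.1 (show |t.re| < 3 / 4 from ht)).1.le)
  have h₂ := tendsto_cubicTail hneg (hs.mono fun t ht => by
    rw [Complex.neg_re]; linarith [(abs_lt.1 (show |t.re| < 3 / 4 from ht)).2])
  have h₃ := tendsto_total.comp tendsto_norm_sq
  have h₄ : Tendsto (fun t : ℂ => (t ^ 2)⁻¹) (Bornology.cobounded ℂ ⊓ 𝓟 strip) (𝓝 0) :=
    tendsto_inv₀_cobounded.comp (tendsto_inf.1 tendsto_norm_sq).1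
  have key := ((h₃.sub (h₄.const_mul (7 / 8))).add ((h₁.add h₂).const_mul (3 / 8))).add_const
    (1 / 2 - 3 / 4 * cubicTail (1 / 2))
  convert key using 2
  · simp only [defect, Function.comp]
    rw [← div_div, div_eq_mul_inv (7 / 8)]
  · ring

theorem mem_strip {t : ℂ} : t ∈ strip ↔ |t.re| < 3 / 4 := Iff.rfl

theorem isOpen_strip : IsOpen strip :=
  isOpen_lt (continuous_abs.comp Complex.continuous_re) continuous_const

theorem strip_eq_preimage : strip = Complex.re ⁻¹' Set.Ioo (-(3 / 4)) (3 / 4) := by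
  ext t
  simp [strip, abs_lt]

theorem convex_strip : Convex ℝ strip := by
  rw [strip_eq_preimage]
  exact (convex_Ioo _ _).linear_preimage Complex.reLm

theorem zero_mem_strip : (0 : ℂ) ∈ strip := by simp [strip]

theorem neg_mem_strip {t : ℂ} (h : t ∈ strip) : -t ∈ strip := by simpa [strip] using h

/-- A periodic holomorphic function on the strip which vanishes at infinity is zero. -/
theorem eq_zero_of_periodic {f : ℂ → ℂ} (hf : DifferentiableOn ℂ f strip)
    (hper : ∀ t : ℂ, -(3 / 4) < t.re → t.re < -(1 / 4) → f (t + 1) = f t)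
    (hlim : Tendsto f (Bornology.cobounded ℂ ⊓ 𝓟 strip) (𝓝 0)) {t₀ : ℂ} (ht₀ : t₀ ∈ strip) :
    f t₀ = 0 := by
  have hred : ∀ t ∈ strip, ∃ t' : ℂ, |t'.re| ≤ 1 / 2 ∧ f t' = f t := by
    intro t ht
    obtain ⟨h₁, h₂⟩ := abs_lt.1 (mem_strip.1 ht)
    rcases lt_or_ge t.re (-(1 / 2)) with h | h
    · refine ⟨t + 1, ?_, hper t h₁ (by linarith)⟩
      rw [Complex.add_re, Complex.one_re, abs_le]
      constructor <;> linarith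
    · rcases lt_or_ge (1 / 2) t.re with h' | h'
      · have e : (t - 1).re = t.re - 1 := by simp
        refine ⟨t - 1, ?_, ?_⟩
        · rw [e, abs_le]
          constructor <;> linarith
        · simpa using (hper (t - 1) (by rw [e]; linarith) (by rw [e]; linarith)).symm
      · exact ⟨t, abs_le.2 ⟨h, h'⟩, rfl⟩
  have hsub : ∀ t : ℂ, |t.re| ≤ 1 / 2 → t ∈ strip := fun t ht => mem_strip.2 (by linarith)
  by_contra hne
  obtain ⟨t₁, ht₁, he₁⟩ := hred t₀ ht₀
  rw [← he₁] at hne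
  have hsmall : ∀ᶠ t in Bornology.cobounded ℂ, t ∈ strip → ‖f t‖ < ‖f t₁‖ := by
    rw [← eventually_inf_principal]
    have := hlim.norm
    rw [norm_zero] at this
    exact this.eventually (gt_mem_nhds (norm_pos_iff.2 hne))
  obtain ⟨R, -, hR⟩ := (Filter.hasBasis_cobounded_norm (E := ℂ)).eventually_iff.1 hsmall
  have hcomp : IsCompact ({t : ℂ | |t.re| ≤ 1 / 2} ∩ Metric.closedBall 0 R) := by
    refine (isCompact_closedBall 0 R).inter_left ?_
    exact isClosed_le (continuous_abs.comp Complex.continuous_re) continuous_const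
  have hmem : ∀ t : ℂ, |t.re| ≤ 1 / 2 → ‖f t₁‖ ≤ ‖f t‖ →
      t ∈ {t : ℂ | |t.re| ≤ 1 / 2} ∩ Metric.closedBall 0 R := by
    intro t ht hle
    refine ⟨ht, mem_closedBall_zero_iff.2 ?_⟩
    by_contra! hlt
    exact absurd (hR (Set.mem_ofPred.2 hlt.le) (hsub t ht)) (not_lt.2 hle)
  obtain ⟨c, ⟨hc, -⟩, hmax⟩ := hcomp.exists_isMaxOn ⟨t₁, hmem t₁ ht₁ le_rfl⟩
    (hf.continuousOn.norm.mono fun t ht => hsub t ht.1)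
  have hmaxS : IsMaxOn (norm ∘ f) strip c := by
    intro t ht
    obtain ⟨t', ht', he⟩ := hred t ht
    rw [Set.mem_ofPred, Function.comp, ← he]
    rcases le_total ‖f t₁‖ ‖f t'‖ with h | h
    · exact hmax (hmem t' ht' h)
    · exact h.trans (hmax (hmem t₁ ht₁ le_rfl))
  have hconst := Complex.eqOn_of_isPreconnected_of_isMaxOn_norm convex_strip.isPreconnected
    isOpen_strip hf (hsub c hc) hmaxS
  have hfar : ((|R| + 1 : ℝ) : ℂ) * Complex.I ∈ strip := by simp [strip]
  have hlt := hR (Set.mem_ofPred.2 (by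
    rw [norm_mul, Complex.norm_I, mul_one, Complex.norm_real, Real.norm_eq_abs]
    exact (by linarith [le_abs_self R] : R ≤ |R| + 1).trans (le_abs_self _))) hfar
  rw [hconst hfar, hconst (hsub t₁ ht₁)] at hlt
  exact lt_irrefl _ hlt

theorem abs_im_le_norm_sin (z : ℂ) : |z.im| ≤ ‖Complex.sin z‖ := by
  have h := abs_norm_sub_norm_le (Complex.exp (-z * Complex.I)) (Complex.exp (z * Complex.I))
  have e : ‖Complex.sin z‖ =
      ‖Complex.exp (-z * Complex.I) - Complex.exp (z * Complex.I)‖ / 2 := by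
    rw [Complex.sin, norm_div, norm_mul, Complex.norm_I, mul_one]
    norm_num
  rw [Complex.norm_exp, Complex.norm_exp] at h
  have hr : (-z * Complex.I).re = z.im := by simp
  have hr' : (z * Complex.I).re = -z.im := by simp
  rw [hr, hr'] at h
  have hs : |z.im| ≤ |Real.sinh z.im| := by
    rw [Real.abs_sinh]
    exact Real.self_le_sinh_iff.2 (abs_nonneg _)
  rw [Real.sinh_eq, abs_div, abs_two] at hs
  rw [e]
  linarith

theorem tendsto_sin_strip : Tendsto (fun t : ℂ => Complex.sin (Real.pi * t))
    (Bornology.cobounded ℂ ⊓ 𝓟 strip) (Bornology.cobounded ℂ) := by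
  rw [← tendsto_norm_atTop_iff_cobounded]
  have h₁ : Tendsto (fun t : ℂ => ‖t‖ - 3 / 4) (Bornology.cobounded ℂ ⊓ 𝓟 strip) atTop :=
    (tendsto_atTop_add_const_right _ _ tendsto_norm_cobounded_atTop).mono_left inf_le_left
  refine tendsto_atTop_mono' _ ?_ h₁
  rw [EventuallyLE, eventually_inf_principal]
  refine Eventually.of_forall fun t ht => ?_
  refine le_trans ?_ (abs_im_le_norm_sin _)
  have hi : (Real.pi * t : ℂ).im = Real.pi * t.im := by simp
  rw [hi, abs_mul, abs_of_pos Real.pi_pos]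
  have := Complex.norm_le_abs_re_add_abs_im t
  have ht' := mem_strip.1 ht
  nlinarith [Real.pi_gt_three, abs_nonneg t.im]

theorem ne_natCast_sq {t : ℂ} (h : t ∈ strip) (j : ℕ) : t ^ 2 - ((j : ℂ) + 1) ^ 2 ≠ 0 := by
  have := (good_sq (mem_strip.1 h).le).sub_natCast_sq j
  rw [← norm_pos_iff]
  linarith

theorem differentiableOn_beta (m : ℕ) : DifferentiableOn ℂ (fun t => beta m (t ^ 2)) strip := by
  have hne := fun (t : ℂ) (ht : t ∈ strip) => ne_natCast_sq ht
  induction m with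
  | zero =>
    simp only [beta]
    refine DifferentiableOn.div (by fun_prop) (by fun_prop) fun t ht => ?_
    have h0 := hne t ht 0
    have h1 := hne t ht 1
    have h2 := hne t ht 2
    have h3 := hne t ht 3
    norm_num at h0 h1 h2 h3
    simp [h0, h1, h2, h3]
  | succ m ih =>
    simp only [beta]
    refine ih.mul (DifferentiableOn.div (by fun_prop) (by fun_prop) fun t ht => ?_)
    refine pow_ne_zero _ ?_
    simpa using hne t ht (m + 4)

theorem differentiableOn_companion (m : ℕ) :
    DifferentiableOn ℂ (fun t => companion m (t ^ 2)) strip := by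
  have hc : Differentiable ℂ fun t : ℂ => certNum (m + 4) (t ^ 2) := by
    unfold certNum; fun_prop
  unfold companion
  exact ((DifferentiableOn.mul (by fun_prop) (differentiableOn_beta m)).mul
    hc.differentiableOn).div_const _

theorem differentiableOn_head : DifferentiableOn ℂ (fun t => head (t ^ 2)) strip := by
  unfold head headNum
  refine DifferentiableOn.div (by fun_prop) (by fun_prop) fun t ht => ?_
  have h0 := ne_natCast_sq ht 0
  have h1 := ne_natCast_sq ht 1
  have h2 := ne_natCast_sq ht 2
  norm_num at h0 h1 h2
  simp [h0, h1, h2]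

theorem differentiableOn_total : DifferentiableOn ℂ (fun t => total (t ^ 2)) strip := by
  unfold total
  refine differentiableOn_head.add fun t ht => ?_
  have ho : IsOpen (strip ∩ Metric.ball 0 (‖t‖ + 1)) := isOpen_strip.inter Metric.isOpen_ball
  have hmem : t ∈ strip ∩ Metric.ball 0 (‖t‖ + 1) := ⟨ht, by simp⟩
  have : DifferentiableOn ℂ (fun w => ∑' m, companion m (w ^ 2))
      (strip ∩ Metric.ball 0 (‖t‖ + 1)) := by
    refine Complex.differentiableOn_tsum_of_summable_norm
      (summable_majorant.mul_right (1 + (‖t‖ + 1) ^ 2))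
      (fun m => (differentiableOn_companion m).mono Set.inter_subset_left) ho fun m w hw => ?_
    refine (norm_companion_le (good_sq (mem_strip.1 hw.1).le) m).trans ?_
    have := (mem_ball_zero_iff.1 hw.2).le
    rw [norm_pow]
    have := majorant_nonneg m
    gcongr
  exact ((this t hmem).differentiableAt (ho.mem_nhds hmem)).differentiableWithinAt

theorem differentiableOn_cubicTail : DifferentiableOn ℂ cubicTail strip := by
  refine Complex.differentiableOn_tsum_of_summable_norm
    ((summable_one_div_succ_pow (p := 3) (by norm_num)).mul_left 64) (fun k => ?_) isOpen_strip
    fun k w hw => norm_cubicTail_term_le (abs_lt.1 (mem_strip.1 hw)).1.le k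
  refine DifferentiableOn.div (by fun_prop) (by fun_prop) fun t ht => pow_ne_zero _ ?_
  have := norm_natCast_add_ge (abs_lt.1 (mem_strip.1 ht)).1.le k
  rw [← norm_pos_iff]
  have : (0 : ℝ) ≤ k := k.cast_nonneg
  linarith

/-- `t ^ 2 * defect t`, continued to `t = 0`. -/
noncomputable def scaledDefect (t : ℂ) : ℂ :=
  total (t ^ 2) - 7 / 8 + t ^ 2 * (3 / 8 * (cubicTail t + cubicTail (-t)) +
    (1 / 2 - 3 / 4 * cubicTail (1 / 2)))

theorem defect_eq_scaledDefect {t : ℂ} (ht : t ≠ 0) : defect t = scaledDefect t / t ^ 2 := by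
  rw [defect, scaledDefect]
  field_simp
  ring

theorem differentiableOn_scaledDefect : DifferentiableOn ℂ scaledDefect strip := by
  have h := differentiableOn_cubicTail
  have h' : DifferentiableOn ℂ (fun t => cubicTail (-t)) strip :=
    h.comp (by fun_prop) fun t ht => neg_mem_strip ht
  unfold scaledDefect
  exact (differentiableOn_total.sub_const _).add
    (DifferentiableOn.mul (by fun_prop) (((h.add h').const_mul _).add_const _))

theorem defect_half : defect (1 / 2) = 0 := by
  rw [defect, show ((1 : ℂ) / 2) ^ 2 = 1 / 4 by norm_num, total_quarter,
    cubicTail_eq (z := -(1 / 2)) (by norm_num), show -(1 / 2 : ℂ) + 1 = 1 / 2 by norm_num]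
  ring

/-- `sin (π t) / t`, continued to `t = 0`. -/
noncomputable def sinSlope : ℂ → ℂ := dslope (fun t => Complex.sin (Real.pi * t)) 0

theorem sinSlope_of_ne {t : ℂ} (ht : t ≠ 0) : sinSlope t = Complex.sin (Real.pi * t) / t := by
  rw [sinSlope, dslope_of_ne _ ht, slope_def_field]
  simp

theorem differentiable_sinSlope : Differentiable ℂ sinSlope := by
  rw [← differentiableOn_univ, sinSlope, Complex.differentiableOn_dslope univ_mem]
  fun_prop

theorem sinSlope_ne_zero {t : ℂ} (ht : t ∈ strip) : sinSlope t ≠ 0 := by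
  rcases eq_or_ne t 0 with rfl | h
  · rw [sinSlope, dslope_same]
    have : HasDerivAt (fun t : ℂ => Complex.sin (Real.pi * t)) (Complex.cos (Real.pi * 0) * (Real.pi * 1)) 0 :=
      (Complex.hasDerivAt_sin _).comp 0 ((hasDerivAt_id (0 : ℂ)).const_mul _)
    rw [this.deriv]
    simp [Real.pi_ne_zero]
  · rw [sinSlope_of_ne h]
    refine div_ne_zero (fun hs => ?_) h
    obtain ⟨k, hk⟩ := Complex.sin_eq_zero_iff.1 hs
    have hpi : (Real.pi : ℂ) ≠ 0 := by exact_mod_cast Real.pi_ne_zero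
    have htk : t = k := by
      rw [mul_comm] at hk
      exact mul_right_cancel₀ hpi hk
    rw [htk, mem_strip, Complex.intCast_re] at ht
    have hk1 : |k| < 1 := by
      have : |(k : ℝ)| < 1 := by linarith
      exact_mod_cast this
    exact h (by rw [htk, Int.abs_lt_one_iff.1 hk1, Int.cast_zero])

theorem sinSlope_neg (t : ℂ) : sinSlope (-t) = sinSlope t := by
  rcases eq_or_ne t 0 with rfl | h
  · simp
  · rw [sinSlope_of_ne h, sinSlope_of_ne (neg_ne_zero.2 h), mul_neg, Complex.sin_neg, neg_div_neg_eq]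

theorem exists_differentiableOn_sq_mul {K : ℂ → ℂ} (hK : DifferentiableOn ℂ K strip)
    (heven : ∀ t, K (-t) = K t) (h0 : K 0 = 0) :
    ∃ f : ℂ → ℂ, DifferentiableOn ℂ f strip ∧ ∀ t ≠ 0, f t = K t / t ^ 2 := by
  have hn : strip ∈ 𝓝 (0 : ℂ) := isOpen_strip.mem_nhds zero_mem_strip
  have hd : deriv K 0 = 0 := by
    have := deriv_comp_neg K 0
    simp only [heven, neg_zero] at this
    exact self_eq_neg.1 this
  refine ⟨dslope (dslope K 0) 0,
    (Complex.differentiableOn_dslope hn).2 ((Complex.differentiableOn_dslope hn).2 hK), ?_⟩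
  intro t ht
  rw [dslope_of_ne _ ht, slope_def_field, dslope_same, hd, dslope_of_ne _ ht, slope_def_field, h0,
    sub_zero, sub_zero, sub_zero, div_div, sq]

theorem defect_eq_zero {t : ℂ} (ht : t ∈ strip) (ht0 : t ≠ 0) : defect t = 0 := by
  obtain ⟨c, hc⟩ : ∃ c, c = scaledDefect 0 * sinSlope 0 ^ 2 := ⟨_, rfl⟩
  obtain ⟨f, hf, hfK⟩ := exists_differentiableOn_sq_mul
    (K := fun t => scaledDefect t - c / sinSlope t ^ 2)
    (differentiableOn_scaledDefect.sub (DifferentiableOn.div (by fun_prop)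
      (differentiable_sinSlope.differentiableOn.pow 2) fun t ht => pow_ne_zero _ (sinSlope_ne_zero ht)))
    (fun t => by
      simp only [sinSlope_neg, scaledDefect, neg_sq, neg_neg]
      ring)
    (by
      have := sinSlope_ne_zero zero_mem_strip
      simp only [hc]
      field_simp
      ring)
  have hfeq : ∀ t ≠ 0, f t = defect t - c * (Complex.sin (Real.pi * t) ^ 2)⁻¹ := by
    intro t ht
    rw [hfK t ht, defect_eq_scaledDefect ht, sinSlope_of_ne ht, sub_div, div_pow, div_div_eq_mul_div,
      mul_div_right_comm, mul_div_cancel_right₀ _ (pow_ne_zero _ ht), div_eq_mul_inv c]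
  have hper : ∀ t : ℂ, -(3 / 4) < t.re → t.re < -(1 / 4) → f (t + 1) = f t := by
    intro t h₁ h₂
    have h0 : t ≠ 0 := by rintro rfl; norm_num at h₂
    have h1 : t + 1 ≠ 0 := by
      intro h
      have := congrArg Complex.re h
      simp at this
      linarith
    rw [hfeq t h0, hfeq _ h1, defect_add_one h₁ h₂, mul_add, mul_one, Complex.sin_add_pi, neg_sq]
  have hlim : Tendsto f (Bornology.cobounded ℂ ⊓ 𝓟 strip) (𝓝 0) := by
    have h := ((tendsto_inv₀_cobounded.comp tendsto_sin_strip).pow 2).const_mul c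
    have := tendsto_defect.sub h
    rw [zero_pow (by norm_num), mul_zero, sub_zero] at this
    refine this.congr' ?_
    refine Eventually.filter_mono inf_le_left ?_
    filter_upwards [Bornology.eventually_ne_cobounded (0 : ℂ)] with t ht
    rw [hfeq t ht, Function.comp, inv_pow]
  have hzero := fun (s : ℂ) (hs : s ∈ strip) => eq_zero_of_periodic hf hper hlim hs
  have hc0 : c = 0 := by
    have h := hzero (1 / 2) (by norm_num [strip])
    rw [hfeq _ (by norm_num), defect_half, mul_one_div, Complex.sin_pi_div_two] at h
    simpa using h
  have h := hzero t ht
  rwa [hfeq t ht0, hc0, zero_mul, sub_zero] at h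

/-- Second difference of `c ↦ c ^ (-3)` with step `x`, divided by `x ^ 2`. -/
noncomputable def secondDifference (c x : ℂ) : ℂ :=
  (12 * c ^ 4 - 6 * c ^ 2 * x ^ 2 + 2 * x ^ 4) / (c ^ 3 * (c ^ 2 - x ^ 2) ^ 3)

theorem one_div_add_cube_add {c x : ℂ} (hc : c ≠ 0) (h₁ : c + x ≠ 0) (h₂ : c - x ≠ 0) :
    1 / (c + x) ^ 3 + 1 / (c - x) ^ 3 - 2 * (1 / c ^ 3) = x ^ 2 * secondDifference c x := by
  rw [secondDifference, show c ^ 2 - x ^ 2 = (c + x) * (c - x) by ring, mul_pow]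
  have : (c + x) ^ 3 ≠ 0 := pow_ne_zero _ h₁
  have : (c - x) ^ 3 ≠ 0 := pow_ne_zero _ h₂
  field_simp
  ring

theorem norm_natCast_add_three_halves (k : ℕ) : ‖(k : ℂ) + 3 / 2‖ = k + 3 / 2 := by
  have : (k : ℂ) + 3 / 2 = ((k + 3 / 2 : ℝ) : ℂ) := by push_cast; ring
  rw [this, Complex.norm_real, Real.norm_eq_abs, abs_of_nonneg (by positivity)]

theorem norm_secondDifference_le {x : ℂ} (hx : ‖x‖ ≤ 1 / 4) (k : ℕ) :
    ‖secondDifference ((k : ℂ) + 3 / 2) x‖ ≤ 160 * (1 / ((k : ℝ) + 1) ^ 5) := by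
  have hk : (0 : ℝ) ≤ k := k.cast_nonneg
  have hc := norm_natCast_add_three_halves k
  generalize (k : ℂ) + 3 / 2 = c at hc
  have hc1 : ‖x‖ ≤ ‖c‖ / 2 := by rw [hc]; linarith
  have hk1 : (k : ℝ) + 1 ≤ ‖c‖ := by rw [hc]; linarith
  have hpos : 0 < ‖c‖ := by linarith
  have hsq : ‖x‖ ^ 2 ≤ ‖c‖ ^ 2 / 4 := by
    calc ‖x‖ ^ 2 ≤ (‖c‖ / 2) ^ 2 := by gcongr
      _ = _ := by ring
  have hden : ‖c‖ ^ 2 / 2 ≤ ‖c ^ 2 - x ^ 2‖ := by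
    have := norm_sub_norm_le (c ^ 2) (x ^ 2)
    rw [norm_pow, norm_pow] at this
    nlinarith [sq_nonneg ‖c‖]
  have hnum : ‖12 * c ^ 4 - 6 * c ^ 2 * x ^ 2 + 2 * x ^ 4‖ ≤ 20 * ‖c‖ ^ 4 := by
    calc ‖12 * c ^ 4 - 6 * c ^ 2 * x ^ 2 + 2 * x ^ 4‖
        ≤ ‖12 * c ^ 4‖ + ‖6 * c ^ 2 * x ^ 2‖ + ‖2 * x ^ 4‖ :=
          (norm_add_le _ _).trans (by gcongr; exact norm_sub_le _ _)
      _ = 12 * ‖c‖ ^ 4 + 6 * ‖c‖ ^ 2 * ‖x‖ ^ 2 + 2 * (‖x‖ ^ 2) ^ 2 := by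
          simp only [norm_mul, norm_pow, Complex.norm_ofNat]
          ring
      _ ≤ 12 * ‖c‖ ^ 4 + 6 * ‖c‖ ^ 2 * (‖c‖ ^ 2 / 4) + 2 * (‖c‖ ^ 2 / 4) ^ 2 := by gcongr
      _ ≤ 20 * ‖c‖ ^ 4 := by nlinarith [pow_pos hpos 4]
  rw [secondDifference, norm_div, norm_mul, norm_pow, norm_pow]
  calc _ ≤ 20 * ‖c‖ ^ 4 / (‖c‖ ^ 3 * (‖c‖ ^ 2 / 2) ^ 3) := by gcongr
    _ = 160 * (1 / ‖c‖ ^ 5) := by field_simp; norm_num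
    _ ≤ _ := by gcongr

theorem cubicTail_add_cubicTail {x : ℂ} (hx : ‖x‖ ≤ 1 / 4) :
    cubicTail (1 / 2 + x) + cubicTail (1 / 2 - x) - 2 * cubicTail (1 / 2) =
      x ^ 2 * ∑' k : ℕ, secondDifference ((k : ℂ) + 3 / 2) x := by
  have hre := abs_le.1 ((Complex.abs_re_le_norm x).trans hx)
  have h₁ : -(3 / 4) ≤ (1 / 2 + x).re := by
    rw [Complex.add_re]; norm_num; linarith
  have h₂ : -(3 / 4) ≤ (1 / 2 - x).re := by
    rw [Complex.sub_re]; norm_num; linarith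
  have s₁ := summable_cubicTail h₁
  have s₂ := summable_cubicTail h₂
  have s₃ := summable_cubicTail (z := 1 / 2) (by norm_num)
  rw [cubicTail, cubicTail, cubicTail, ← s₁.tsum_add s₂, ← tsum_mul_left,
    ← (s₁.add s₂).tsum_sub (s₃.mul_left 2), ← tsum_mul_left]
  refine tsum_congr fun k => ?_
  have hn := norm_natCast_add_three_halves k
  have hk : (0 : ℝ) ≤ k := k.cast_nonneg
  have ha : (k : ℂ) + 1 + (1 / 2 + x) = k + 3 / 2 + x := by ring
  have hb : (k : ℂ) + 1 + (1 / 2 - x) = k + 3 / 2 - x := by ring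
  have hc : (k : ℂ) + 1 + 1 / 2 = k + 3 / 2 := by ring
  rw [ha, hb, hc]
  have hs := norm_sub_norm_le ((k : ℂ) + 3 / 2) x
  have hs' := norm_sub_norm_le ((k : ℂ) + 3 / 2) (-x)
  rw [sub_neg_eq_add, norm_neg] at hs'
  refine one_div_add_cube_add ?_ ?_ ?_ <;> rw [← norm_pos_iff] <;> linarith

/-- The numerator of the rational part of the expansion at `t = 1 / 2`. -/
noncomputable def remainderNum (x : ℂ) : ℂ :=
  (3877439716675275525 - 522878571018063000 * x - 3018492339525234396 * x ^ 2 - 24578559813083172480 * x ^ 3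
    - 48120514462710605120 * x ^ 4 + 67794053236625912320 * x ^ 5 + 98087878213634447104 * x ^ 6 - 26964964156696811520 * x ^ 7
    - 60827189310099141120 * x ^ 8 - 1352568835663564800 * x ^ 9 + 17898036213816530944 * x ^ 10 + 3001863429524193280 * x ^ 11
    - 2731072391717273600 * x ^ 12 - 756206096699228160 * x ^ 13 + 190042534728105984 * x ^ 14 + 80946297734430720 * x ^ 15
    - 1418925561282560 * x ^ 16 - 3274435773071360 * x ^ 17 - 327443577307136 * x ^ 18) / 1053888675840000

theorem remainderNum_identity (x : ℂ) :
    (7 / 8 - (1 / 2 + x) ^ 2 / 2) *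
        (((1 / 2 + x) ^ 2 - 1) * ((1 / 2 + x) ^ 2 - 4) * ((1 / 2 + x) ^ 2 - 9)) ^ 3 +
      3 / 8 * (1 / 2 + x) ^ 2 * (x + 3 / 2) ^ 3 *
        (((1 / 2 + x) ^ 2 - 4) * ((1 / 2 + x) ^ 2 - 9)) ^ 3 - headNum ((1 / 2 + x) ^ 2) =
      x ^ 2 * remainderNum x := by
  unfold headNum remainderNum
  ring

theorem half_add_mem_strip {x : ℂ} (hx : ‖x‖ < 1 / 4) : 1 / 2 + x ∈ strip := by
  have hre := abs_lt.1 ((Complex.abs_re_le_norm x).trans_lt hx)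
  rw [mem_strip, Complex.add_re, abs_lt]
  norm_num
  constructor <;> linarith

/-- `companion m u` without its factor `(u - 1 / 4) ^ 2`. -/
noncomputable def reducedCompanion (m : ℕ) (u : ℂ) : ℂ :=
  beta m u * certNum (m + 4) u / certDen (m + 4)

theorem tsum_companion_near_half {x : ℂ} (hx : ‖x‖ < 1 / 4) (hx0 : x ≠ 0) :
    (1 + x) ^ 2 * ∑' m, reducedCompanion m ((1 / 2 + x) ^ 2) =
      remainderNum x /
        (((1 / 2 + x) ^ 2 - 1) * ((1 / 2 + x) ^ 2 - 4) * ((1 / 2 + x) ^ 2 - 9)) ^ 3 -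
      3 / 8 * (1 / 2 + x) ^ 2 * ∑' k : ℕ, secondDifference ((k : ℂ) + 3 / 2) x := by
  have hmem := half_add_mem_strip hx
  have hre := abs_lt.1 ((Complex.abs_re_le_norm x).trans_lt hx)
  have ht0 : 1 / 2 + x ≠ 0 := by
    intro h
    have := congrArg Complex.re h
    rw [Complex.add_re] at this
    norm_num at this
    linarith
  have hdef := defect_eq_zero hmem ht0
  have htail := cubicTail_add_cubicTail hx.le
  have hneg := cubicTail_eq (z := -(1 / 2 + x)) (by
    rw [Complex.neg_re, Complex.add_re]; norm_num; linarith)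
  rw [show -(1 / 2 + x) + 1 = 1 / 2 - x by ring] at hneg
  have hcomp : ∑' m, companion m ((1 / 2 + x) ^ 2) =
      x ^ 2 * ((1 + x) ^ 2 * ∑' m, reducedCompanion m ((1 / 2 + x) ^ 2)) := by
    rw [← tsum_mul_left, ← tsum_mul_left]
    refine tsum_congr fun m => ?_
    rw [companion, reducedCompanion]
    ring
  have h0 := ne_natCast_sq hmem 0
  have h1 := ne_natCast_sq hmem 1
  have h2 := ne_natCast_sq hmem 2
  norm_num at h0 h1 h2
  have hpoly := remainderNum_identity x
  rw [defect, hneg, total, head, hcomp] at hdef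
  refine mul_left_cancel₀ (pow_ne_zero 2 hx0) ?_
  generalize ∑' m, reducedCompanion m ((1 / 2 + x) ^ 2) = S at *
  generalize ∑' k : ℕ, secondDifference ((k : ℂ) + 3 / 2) x = B at *
  have hfac : (1 / 2 + x) ^ 2 - 1 = -(1 + -(1 / 2 + x)) * (x + 3 / 2) := by ring
  have hA : 1 + -(1 / 2 + x) ≠ 0 := by
    intro h; rw [hfac, h] at h0; simp at h0
  have hB : x + 3 / 2 ≠ 0 := by
    intro h; rw [hfac, h] at h0; simp at h0
  have hcube : 1 / (1 + -(1 / 2 + x)) ^ 3 = -(x + 3 / 2) ^ 3 / ((1 / 2 + x) ^ 2 - 1) ^ 3 := by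
    rw [hfac]
    generalize 1 + -(1 / 2 + x) = A at *
    generalize x + 3 / 2 = C at *
    field_simp
  rw [hcube] at hdef
  have hw : (((1 / 2 + x) ^ 2 - 1) * ((1 / 2 + x) ^ 2 - 4) * ((1 / 2 + x) ^ 2 - 9)) ^ 3 ≠ 0 :=
    pow_ne_zero _ (mul_ne_zero (mul_ne_zero h0 h1) h2)
  rw [mul_sub, ← mul_div_assoc, ← hpoly]
  generalize cubicTail (1 / 2 + x) = c₁ at *
  generalize cubicTail (1 / 2 - x) = c₂ at *
  generalize cubicTail (1 / 2) = c₃ at *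
  generalize headNum ((1 / 2 + x) ^ 2) = h at *
  have hc₂ : c₂ = x ^ 2 * B + 2 * c₃ - c₁ := by linear_combination htail
  rw [hc₂] at hdef
  clear hpoly hneg htail hcomp hc₂ hcube hfac
  generalize (1 / 2 + x) ^ 2 - 1 = U at *
  generalize (1 / 2 + x) ^ 2 - 4 = V at *
  generalize (1 / 2 + x) ^ 2 - 9 = Z at *
  generalize 1 / 2 + x = t at *
  field_simp at hdef ⊢
  linear_combination hdef / 4

theorem tendsto_tsum_reducedCompanion :
    Tendsto (fun x : ℂ => ∑' m, reducedCompanion m ((1 / 2 + x) ^ 2)) (𝓝 0)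
      (𝓝 (∑' m, reducedCompanion m (1 / 4))) := by
  refine tendsto_tsum_of_dominated_convergence summable_majorant (fun m => ?_) ?_
  · have hmem : (1 / 2 : ℂ) ∈ strip := by norm_num [strip]
    have hc : Differentiable ℂ fun t : ℂ => certNum (m + 4) (t ^ 2) := by
      unfold certNum; fun_prop
    have hd : DifferentiableOn ℂ (fun t => reducedCompanion m (t ^ 2)) strip := by
      unfold reducedCompanion
      exact ((differentiableOn_beta m).mul hc.differentiableOn).div_const _
    have hcont : ContinuousAt (fun t => reducedCompanion m (t ^ 2)) (1 / 2) :=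
      (hd.continuousOn).continuousAt (isOpen_strip.mem_nhds hmem)
    have ha : Tendsto (fun x : ℂ => 1 / 2 + x) (𝓝 0) (𝓝 (1 / 2)) := by
      have : Continuous fun x : ℂ => 1 / 2 + x := by fun_prop
      simpa using this.tendsto 0
    have := hcont.tendsto.comp ha
    rwa [show ((1 : ℂ) / 2) ^ 2 = 1 / 4 by norm_num] at this
  · filter_upwards [Metric.ball_mem_nhds (0 : ℂ) (show (0 : ℝ) < 1 / 4 by norm_num)] with x hx m
    have hg := good_sq (mem_strip.1 (half_add_mem_strip (mem_ball_zero_iff.1 hx))).le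
    refine le_trans ?_ (norm_beta_mul_certNum_le hg m)
    exact le_mul_of_one_le_right (norm_nonneg _) (by linarith [norm_nonneg ((1 / 2 + x) ^ 2)])

theorem tendsto_tsum_secondDifference :
    Tendsto (fun x : ℂ => ∑' k : ℕ, secondDifference ((k : ℂ) + 3 / 2) x) (𝓝 0)
      (𝓝 (∑' k : ℕ, 12 * (1 / ((k : ℂ) + 3 / 2) ^ 5))) := by
  refine tendsto_tsum_of_dominated_convergence
    ((summable_one_div_succ_pow (p := 5) (by norm_num)).mul_left 160) (fun k => ?_) ?_
  · have hc : (k : ℂ) + 3 / 2 ≠ 0 := by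
      rw [← norm_pos_iff, norm_natCast_add_three_halves]; positivity
    generalize (k : ℂ) + 3 / 2 = c at hc
    have h : ContinuousAt (secondDifference c) 0 := by
      unfold secondDifference
      refine ContinuousAt.div (by fun_prop) (by fun_prop) ?_
      simpa using hc
    have e : secondDifference c 0 = 12 * (1 / c ^ 5) := by
      rw [secondDifference]
      field_simp
      ring
    rw [← e]
    exact h.tendsto
  · filter_upwards [Metric.ball_mem_nhds (0 : ℂ) (show (0 : ℝ) < 1 / 4 by norm_num)] with x hx k
    exact norm_secondDifference_le (mem_ball_zero_iff.1 hx).le k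

theorem tsum_reducedCompanion :
    ∑' m, reducedCompanion m (1 / 4) =
      -638261681757247 / 2585533732031250 - 9 / 8 * ∑' k : ℕ, 1 / ((k : ℂ) + 3 / 2) ^ 5 := by
  have hpow : Tendsto (fun x : ℂ => (1 + x) ^ 2) (𝓝 0) (𝓝 ((1 + 0) ^ 2)) :=
    Continuous.tendsto (by fun_prop) 0
  have hu : Tendsto (fun x : ℂ => 3 / 8 * (1 / 2 + x) ^ 2) (𝓝 0) (𝓝 (3 / 8 * (1 / 2 + 0) ^ 2)) :=
    Continuous.tendsto (f := fun x : ℂ => 3 / 8 * (1 / 2 + x) ^ 2) (by fun_prop) 0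
  have hrem : Tendsto (fun x : ℂ => remainderNum x /
        (((1 / 2 + x) ^ 2 - 1) * ((1 / 2 + x) ^ 2 - 4) * ((1 / 2 + x) ^ 2 - 9)) ^ 3) (𝓝 0)
      (𝓝 (-638261681757247 / 2585533732031250)) := by
    have hc : Continuous remainderNum := by unfold remainderNum; fun_prop
    have : ContinuousAt (fun x : ℂ => remainderNum x /
        (((1 / 2 + x) ^ 2 - 1) * ((1 / 2 + x) ^ 2 - 4) * ((1 / 2 + x) ^ 2 - 9)) ^ 3) 0 :=
      ContinuousAt.div hc.continuousAt (by fun_prop) (by norm_num)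
    have h := this.tendsto
    convert h using 2
    norm_num [remainderNum]
  have hl := (hpow.mul tendsto_tsum_reducedCompanion).mono_left (nhdsWithin_le_nhds (s := {0}ᶜ))
  have hr := (hrem.sub (hu.mul tendsto_tsum_secondDifference)).mono_left
    (nhdsWithin_le_nhds (s := {0}ᶜ))
  have heq : ∀ᶠ x : ℂ in 𝓝[≠] 0, (1 + x) ^ 2 * ∑' m, reducedCompanion m ((1 / 2 + x) ^ 2) =
      remainderNum x /
        (((1 / 2 + x) ^ 2 - 1) * ((1 / 2 + x) ^ 2 - 4) * ((1 / 2 + x) ^ 2 - 9)) ^ 3 -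
      3 / 8 * (1 / 2 + x) ^ 2 * ∑' k : ℕ, secondDifference ((k : ℂ) + 3 / 2) x := by
    filter_upwards [self_mem_nhdsWithin, mem_nhdsWithin_of_mem_nhds
      (Metric.ball_mem_nhds (0 : ℂ) (show (0 : ℝ) < 1 / 4 by norm_num))] with x hx0 hx
    exact tsum_companion_near_half (mem_ball_zero_iff.1 hx) hx0
  have key := tendsto_nhds_unique (hl.congr' heq) hr
  rw [tsum_mul_left] at key
  linear_combination key

/-- The hypergeometric factor of the series. -/
noncomputable def hyperTerm (n : ℕ) : ℝ :=
  (Nat.factorial n : ℝ) ^ 9 * (-(1024 / 3125 : ℝ)) ^ n /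
    (poch (1 / 2) n ^ 5 * poch (1 / 5) n * poch (2 / 5) n * poch (3 / 5) n * poch (4 / 5) n)

theorem poch_succ (a : ℝ) (n : ℕ) : poch a (n + 1) = poch a n * (a + n) :=
  Finset.prod_range_succ _ _

theorem hyperTerm_succ (n : ℕ) : hyperTerm (n + 1) = hyperTerm n *
    (-32768 / 5 * ((n : ℝ) + 1) ^ 9 / ((2 * n + 1) ^ 5 *
      ((5 * n + 1) * (5 * n + 2) * (5 * n + 3) * (5 * n + 4)))) := by
  have e : ∀ a b : ℝ, a / (5 : ℝ) + b = (5 * b + a) / 5 := fun a b => by ring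
  have e' : ∀ b : ℝ, 1 / (2 : ℝ) + b = (2 * b + 1) / 2 := fun b => by ring
  simp only [hyperTerm, poch_succ, e, e', Nat.factorial_succ, Nat.cast_mul, Nat.cast_succ]
  simp only [div_eq_mul_inv, mul_inv, mul_pow, inv_pow, pow_succ (-(1024 * 3125⁻¹) : ℝ) n, inv_inv]
  generalize ((n : ℝ) + 1) ^ 9 = A
  generalize ((2 * (n : ℝ) + 1) ^ 5)⁻¹ = B
  ring

theorem hyperTerm_one : hyperTerm 1 = -4096 / 15 := by
  norm_num [hyperTerm, poch]

theorem hyperTerm_two : hyperTerm 2 = 4294967296 / 3444525 := by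
  rw [hyperTerm_succ, hyperTerm_one]; norm_num

theorem hyperTerm_three : hyperTerm 3 = -17592186044416 / 8211328125 := by
  rw [hyperTerm_succ, hyperTerm_two]; norm_num

theorem hyperTerm_four : hyperTerm 4 = 4722366482869645213696 / 2005943253767578125 := by
  rw [hyperTerm_succ, hyperTerm_three]; norm_num

theorem ofReal_hyperTerm_succ (n : ℕ) : (hyperTerm (n + 1) : ℂ) = hyperTerm n *
    (-32768 / 5 * ((n : ℂ) + 1) ^ 9 / ((2 * n + 1) ^ 5 *
      ((5 * n + 1) * (5 * n + 2) * (5 * n + 3) * (5 * n + 4)))) := by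
  rw [hyperTerm_succ]
  push_cast
  ring

/-- The nonvanishing linear factors at `n = m + 4`. -/
structure Regular (z : ℂ) : Prop where
  a0 : z ≠ 0
  a1 : z - 1 ≠ 0
  a2 : z - 2 ≠ 0
  a3 : z - 3 ≠ 0
  a4 : z + 1 ≠ 0
  b1 : z * 2 - 1 ≠ 0
  b2 : z * 2 + 1 ≠ 0
  b3 : z * 2 + 3 ≠ 0
  c0 : 5 * z - 1 ≠ 0
  c1 : 5 * z + 1 ≠ 0
  c2 : 5 * z + 2 ≠ 0
  c3 : 5 * z + 3 ≠ 0
  c4 : 5 * z + 4 ≠ 0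

theorem regular_natCast (m : ℕ) : Regular ((m + 4 : ℕ) : ℂ) := by
  have key : ∀ (a b : ℕ) (w : ℂ), w = ((a * m + b + 1 : ℕ) : ℂ) → w ≠ 0 := fun a b w h => by
    rw [h]; exact Nat.cast_ne_zero.2 (Nat.succ_ne_zero _)
  constructor
  · exact key 1 3 _ (by push_cast; ring)
  · exact key 1 2 _ (by push_cast; ring)
  · exact key 1 1 _ (by push_cast; ring)
  · exact key 1 0 _ (by push_cast; ring)
  · exact key 1 4 _ (by push_cast; ring)
  · exact key 2 6 _ (by push_cast; ring)
  · exact key 2 8 _ (by push_cast; ring)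
  · exact key 2 10 _ (by push_cast; ring)
  · exact key 5 18 _ (by push_cast; ring)
  · exact key 5 20 _ (by push_cast; ring)
  · exact key 5 21 _ (by push_cast; ring)
  · exact key 5 22 _ (by push_cast; ring)
  · exact key 5 23 _ (by push_cast; ring)

theorem beta_quarter (m : ℕ) : beta m (1 / 4) = -15 / 64 * hyperTerm (m + 4) *
    (5 * ((m + 4 : ℕ) : ℂ) - 1) / (((m + 4 : ℕ) : ℂ) ^ 6 * (((m + 4 : ℕ) : ℂ) - 1) ^ 2 *
      (((m + 4 : ℕ) : ℂ) - 2) * (((m + 4 : ℕ) : ℂ) - 3) * (2 * ((m + 4 : ℕ) : ℂ) + 1) ^ 3) := by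
  induction m with
  | zero =>
    rw [zero_add, hyperTerm_four, beta]
    push_cast
    norm_num
  | succ m ih =>
    have hz := regular_natCast m
    rw [beta, ih, show m + 1 + 4 = m + 4 + 1 by ring, ofReal_hyperTerm_succ (m + 4), weightRatio, certDen]
    rw [show (m : ℂ) + 4 = ((m + 4 : ℕ) : ℂ) by push_cast; ring,
      show ((m + 4 + 1 : ℕ) : ℂ) = ((m + 4 : ℕ) : ℂ) + 1 by push_cast; ring]
    generalize (hyperTerm (m + 4) : ℂ) = h
    generalize ((m + 4 : ℕ) : ℂ) = z at *
    obtain ⟨a0, a1, a2, a3, a4, b1, b2, b3, c0, c1, c2, c3, c4⟩ := hz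
    rw [show (1 / 4 - (z + 1) ^ 2 : ℂ) = -((2 * z + 1) * (2 * z + 3)) / 4 by ring,
      show (1 / 4 - (2 * z - 1 / 2) ^ 2 : ℂ) = -((2 * z - 1) * (2 * z)) by ring,
      show (1 / 4 - (2 * z + 1 / 2) ^ 2 : ℂ) = -((2 * z + 1) * (2 * z)) by ring,
      show (4 * (1 / 4) - (z - 2) ^ 2 : ℂ) = -((z - 1) * (z - 3)) by ring,
      show z + 1 - 1 = z by ring, show z + 1 - 2 = z - 1 by ring, show z + 1 - 3 = z - 2 by ring,
      show 5 * (z + 1) - 1 = 5 * z + 4 by ring, show 2 * (z + 1) + 1 = 2 * z + 3 by ring]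
    field_simp
    ring

/-- The polynomial weight of the series. -/
noncomputable def weight (z : ℂ) : ℂ :=
  5532 * z ^ 4 - 5600 * z ^ 3 + 2275 * z ^ 2 - 425 * z + 30

/-- The telescoping part relating the series to the companion sum at `1 / 4`. -/
noncomputable def telescope (n : ℕ) : ℂ :=
  hyperTerm n * ((2 * n - 1) ^ 2 * (5 * n - 1) * (30 - 185 * n + 315 * n ^ 2)) /
    (n ^ 9 * (n - 1))

theorem certNum_quarter (z : ℂ) : certNum z (1 / 4) =
    1 / 4 * (z ^ 2 * (z - 1) * (z - 2) * (z - 3) * (2 * z + 1) * (2 * z - 1)) *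
      (-6 - 55 * z - 6 * z ^ 2 + 1579 * z ^ 3 - 784 * z ^ 4 + 648 * z ^ 5 + 21856 * z ^ 6 +
        22128 * z ^ 7) := by
  unfold certNum
  ring

theorem reducedCompanion_quarter (m : ℕ) : reducedCompanion m (1 / 4) =
    3 / 32768 * (weight ((m + 4 : ℕ) : ℂ) / ((m + 4 : ℕ) : ℂ) ^ 9 * hyperTerm (m + 4) +
      telescope (m + 1 + 4) - telescope (m + 4)) := by
  have hz := regular_natCast m
  rw [reducedCompanion, beta_quarter, telescope, telescope, show m + 1 + 4 = m + 4 + 1 by ring,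
    ofReal_hyperTerm_succ (m + 4), certDen, weight,
    show (m : ℂ) + 4 = ((m + 4 : ℕ) : ℂ) by push_cast; ring,
      show ((m + 4 + 1 : ℕ) : ℂ) = ((m + 4 : ℕ) : ℂ) + 1 by push_cast; ring]
  rw [certNum_quarter]
  generalize (hyperTerm (m + 4) : ℂ) = h
  generalize ((m + 4 : ℕ) : ℂ) = z at *
  obtain ⟨a0, a1, a2, a3, a4, b1, b2, b3, c0, c1, c2, c3, c4⟩ := hz
  rw [show z + 1 - 1 = z by ring, show 5 * (z + 1) - 1 = 5 * z + 4 by ring,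
    show 2 * (z + 1) - 1 = 2 * z + 1 by ring]
  field_simp
  ring

theorem summable_telescope : Summable fun m : ℕ => telescope (m + 4) := by
  refine Summable.of_norm_bounded summable_majorant fun m => ?_
  have hz := regular_natCast m
  have hg : Good (1 / 4) := by left; norm_num
  have hb := norm_beta_le hg m
  have hb' : ‖beta m (1 / 4)‖ ≤ 4 ^ 36 * 200 ^ 12 * (4 / 5) ^ m :=
    (le_mul_of_one_le_right (norm_nonneg _)
      (one_le_pow₀ (by linarith [norm_nonneg (1 / 4 : ℂ)]))).trans hb
  obtain ⟨r, hr⟩ : ∃ r : ℝ, r = 64 / 15 * ((m + 3) * (m + 2) * (m + 1) * (2 * m + 9) ^ 3 *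
      (2 * m + 7) ^ 2 * (30 - 185 * (m + 4) + 315 * (m + 4) ^ 2)) / ((m : ℝ) + 4) ^ 3 := ⟨_, rfl⟩
  have hm : (0 : ℝ) ≤ m := m.cast_nonneg
  have hpoly : (30 - 185 * ((m : ℝ) + 4) + 315 * (m + 4) ^ 2) = 315 * m ^ 2 + 2335 * m + 4330 := by
    ring
  have hr0 : 0 ≤ r := by rw [hr, hpoly]; positivity
  have hr1 : r ≤ 12000000 * ((m : ℝ) + 4) ^ 14 := by
    rw [hr, hpoly, div_le_iff₀ (by positivity)]
    have hq : 0 ≤ (m : ℝ) + 3 := by positivity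
    calc _ ≤ 64 / 15 * (((m : ℝ) + 4) * (m + 4) * (m + 4) * (3 * (m + 4)) ^ 3 *
          (2 * (m + 4)) ^ 2 * (315 * (m + 4) ^ 2)) := by
          gcongr <;> nlinarith
      _ = 145152 * ((m : ℝ) + 4) ^ 10 := by ring
      _ ≤ 12000000 * ((m : ℝ) + 4) ^ 17 := by
          gcongr
          · norm_num
          · linarith
          · norm_num
      _ = _ := by ring
  have he : telescope (m + 4) = -(r : ℂ) * beta m (1 / 4) := by
    rw [beta_quarter, telescope, hr]
    push_cast at hz ⊢
    generalize (hyperTerm (m + 4) : ℂ) = h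
    rw [show (m : ℂ) + 3 = m + 4 - 1 by ring, show (m : ℂ) + 2 = m + 4 - 2 by ring,
      show (m : ℂ) + 1 = m + 4 - 3 by ring, show 2 * (m : ℂ) + 9 = 2 * (m + 4) + 1 by ring,
      show 2 * (m : ℂ) + 7 = 2 * (m + 4) - 1 by ring]
    generalize (m : ℂ) + 4 = z at *
    obtain ⟨a0, a1, a2, a3, a4, b1, b2, b3, c0, c1, c2, c3, c4⟩ := hz
    have b2' : 2 * z + 1 ≠ 0 := by rwa [mul_comm]
    field_simp
  rw [he, norm_mul, norm_neg, Complex.norm_real, Real.norm_of_nonneg hr0, majorant]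
  calc _ ≤ 12000000 * ((m : ℝ) + 4) ^ 14 * (4 ^ 36 * 200 ^ 12 * (4 / 5) ^ m) := by gcongr
    _ = _ := by ring

theorem summable_reducedCompanion : Summable fun m => reducedCompanion m (1 / 4) := by
  have hg : Good (1 / 4) := by left; norm_num
  refine Summable.of_norm_bounded summable_majorant fun m =>
    le_trans ?_ (norm_beta_mul_certNum_le hg m)
  exact le_mul_of_one_le_right (norm_nonneg _) (by linarith [norm_nonneg (1 / 4 : ℂ)])

theorem hasSum_weight_tail :
    HasSum (fun m : ℕ => weight ((m + 4 : ℕ) : ℂ) / ((m + 4 : ℕ) : ℂ) ^ 9 * hyperTerm (m + 4))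
      (32768 / 3 * ∑' m, reducedCompanion m (1 / 4) + telescope 4) := by
  have hw := summable_telescope
  have hw' : Summable fun m : ℕ => telescope (m + 1 + 4) :=
    (summable_nat_add_iff (f := fun m => telescope (m + 4)) 1).2 hw
  have e : 32768 / 3 * ∑' m, reducedCompanion m (1 / 4) + telescope 4 =
      32768 / 3 * ∑' m, reducedCompanion m (1 / 4) - ∑' m, telescope (m + 1 + 4) +
        ∑' m, telescope (m + 4) := by
    rw [hw.tsum_eq_zero_add]
    ring_nf
  have hfun : (fun m : ℕ => weight ((m + 4 : ℕ) : ℂ) / ((m + 4 : ℕ) : ℂ) ^ 9 *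
      (hyperTerm (m + 4) : ℂ)) = fun m => 32768 / 3 * reducedCompanion m (1 / 4) -
        telescope (m + 1 + 4) + telescope (m + 4) := by
    funext m
    rw [reducedCompanion_quarter]
    ring
  rw [e, hfun]
  exact ((summable_reducedCompanion.hasSum.mul_left (32768 / 3)).sub hw'.hasSum).add hw.hasSum

theorem tsum_one_div_odd_half :
    ∑' k : ℕ, 1 / ((k : ℝ) + 3 / 2) ^ 5 = 31 * ∑' k : ℕ, 1 / ((k : ℝ) + 1) ^ 5 - 32 := by
  have hs : Summable fun k : ℕ => 1 / ((k : ℝ) + 1) ^ 5 := summable_one_div_succ_pow (by norm_num)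
  have he : Summable fun k : ℕ => 1 / (((2 * k : ℕ) : ℝ) + 1) ^ 5 :=
    hs.comp_injective (i := fun k : ℕ => 2 * k) fun a b h => by simpa using h
  have ho : Summable fun k : ℕ => 1 / (((2 * k + 1 : ℕ) : ℝ) + 1) ^ 5 :=
    hs.comp_injective (i := fun k : ℕ => 2 * k + 1) fun a b h => by simpa using h
  have key := tsum_even_add_odd (f := fun k : ℕ => 1 / ((k : ℝ) + 1) ^ 5) he ho
  have e₁ : ∑' k : ℕ, 1 / (((2 * k + 1 : ℕ) : ℝ) + 1) ^ 5 =
      1 / 32 * ∑' k : ℕ, 1 / ((k : ℝ) + 1) ^ 5 := by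
    rw [← tsum_mul_left]
    refine tsum_congr fun k => ?_
    push_cast
    field_simp
    ring
  have e₂ : ∑' k : ℕ, 1 / (((2 * k : ℕ) : ℝ) + 1) ^ 5 =
      1 + 1 / 32 * ∑' k : ℕ, 1 / ((k : ℝ) + 3 / 2) ^ 5 := by
    rw [he.tsum_eq_zero_add, ← tsum_mul_left]
    congr 1
    · norm_num
    · refine tsum_congr fun k => ?_
      push_cast
      field_simp
      ring
  rw [e₁, e₂] at key
  linear_combination 32 * key

end QuinticZeta

open QuinticZeta in
/-- Au's identity:
`∑_{n≥1} (5532n⁴−5600n³+2275n²−425n+30)/n⁹ · n!⁹(−1024/3125)ⁿ /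
  ([1/2]_n⁵[1/5]_n[2/5]_n[3/5]_n[4/5]_n) = −380928 ζ(5)`. -/
theorem stmt_2 :
    ∑' n : ℕ,
      (5532 * ((n : ℝ) + 1) ^ 4 - 5600 * ((n : ℝ) + 1) ^ 3 + 2275 * ((n : ℝ) + 1) ^ 2
          - 425 * ((n : ℝ) + 1) + 30) / ((n : ℝ) + 1) ^ 9 *
        (((Nat.factorial (n + 1) : ℝ)) ^ 9 * (-(1024 / 3125 : ℝ)) ^ (n + 1) /
          ((poch (1 / 2) (n + 1)) ^ 5 * poch (1 / 5) (n + 1) * poch (2 / 5) (n + 1) *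
            poch (3 / 5) (n + 1) * poch (4 / 5) (n + 1)))
      = -380928 * ∑' k : ℕ, 1 / ((k : ℝ) + 1) ^ 5 := by
  have hfun : ∀ n : ℕ, (((5532 * ((n : ℝ) + 1) ^ 4 - 5600 * ((n : ℝ) + 1) ^ 3 +
      2275 * ((n : ℝ) + 1) ^ 2 - 425 * ((n : ℝ) + 1) + 30) / ((n : ℝ) + 1) ^ 9 *
        hyperTerm (n + 1) : ℝ) : ℂ) =
      weight ((n + 1 : ℕ) : ℂ) / ((n + 1 : ℕ) : ℂ) ^ 9 * hyperTerm (n + 1) := fun n => by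
    rw [weight]; push_cast; ring
  change ∑' n : ℕ, _ / _ * hyperTerm (n + 1) = _
  apply Complex.ofReal_injective
  rw [Complex.ofReal_tsum]
  simp only [hfun]
  have hsum : Summable fun n : ℕ =>
      weight ((n + 1 : ℕ) : ℂ) / ((n + 1 : ℕ) : ℂ) ^ 9 * (hyperTerm (n + 1) : ℂ) :=
    (summable_nat_add_iff 3).1 hasSum_weight_tail.summable
  have hzeta : ∑' k : ℕ, 1 / ((k : ℂ) + 3 / 2) ^ 5 =
      ((31 * ∑' k : ℕ, 1 / ((k : ℝ) + 1) ^ 5 - 32 : ℝ) : ℂ) := by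
    rw [← tsum_one_div_odd_half, Complex.ofReal_tsum]
    push_cast
    rfl
  rw [← hsum.sum_add_tsum_nat_add 3]
  change _ + ∑' m : ℕ, weight ((m + 4 : ℕ) : ℂ) / ((m + 4 : ℕ) : ℂ) ^ 9 * (hyperTerm (m + 4) : ℂ) = _
  rw [hasSum_weight_tail.tsum_eq, tsum_reducedCompanion, hzeta, telescope, hyperTerm_four]
  simp only [Finset.sum_range_succ, Finset.sum_range_zero, zero_add, Nat.reduceAdd, hyperTerm_one,
    hyperTerm_two, hyperTerm_three, weight]
  push_cast
  ring
end
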